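/- arXiv:math/9803012 — 4 statements merged into one kernel-verified Lean document; each statement's English description precedes it below -/
import Mathlib

section
/- The only solutions to the simultaneous Diophantine equations (X+2)^2 - 10Y^2 = -1 and (X-2)^2 - 2Z^2 = -1 in integers are (X, Y, Z) = (1, ±1, ±1) and (-5, ±1, ±5). -/
/-- Coefficients of `(3 + 2√2)^n`. -/
def pellP : ℕ → ℤ × ℤ
  | 0 => (1, 0)
  | n + 1 => (3 * (pellP n).1 + 4 * (pellP n).2, 2 * (pellP n).1 + 3 * (pellP n).2)

def pA (n : ℕ) : ℤ := (pellP n).1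
def pB (n : ℕ) : ℤ := (pellP n).2

lemma pA_zero : pA 0 = 1 := rfl
lemma pB_zero : pB 0 = 0 := rfl
lemma pA_succ (n : ℕ) : pA (n + 1) = 3 * pA n + 4 * pB n := rfl
lemma pB_succ (n : ℕ) : pB (n + 1) = 2 * pA n + 3 * pB n := rfl

lemma p_add (m n : ℕ) : pA (m + n) = pA m * pA n + 2 * pB m * pB n ∧
    pB (m + n) = pA m * pB n + pB m * pA n := by
  induction n with
  | zero => simp [pA_zero, pB_zero]
  | succ n ih =>
    rw [← add_assoc, pA_succ, pB_succ, pA_succ, pB_succ, ih.1, ih.2]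
    constructor <;> ring

lemma p_norm (n : ℕ) : pA n ^ 2 - 2 * pB n ^ 2 = 1 := by
  induction n with
  | zero => simp [pA_zero, pB_zero]
  | succ n ih => rw [pA_succ, pB_succ]; linarith

lemma p_pos (n : ℕ) : 0 < pA n ∧ 0 ≤ pB n := by
  induction n with
  | zero => simp [pA_zero, pB_zero]
  | succ n ih => rw [pA_succ, pB_succ]; constructor <;> linarith [ih.1, ih.2]

lemma pA_two (m : ℕ) : pA (2 * m) = 2 * pA m ^ 2 - 1 := by
  rw [two_mul, (p_add m m).1]; linarith [p_norm m]

lemma pB_two (m : ℕ) : pB (2 * m) = 2 * pA m * pB m := by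
  rw [two_mul, (p_add m m).2]; ring

lemma p_odd_mul (m j : ℕ) : pA m ∣ pA (2 * m * (2 * j + 1)) + 1 ∧
    pA m ∣ pB (2 * m * (2 * j + 1)) := by
  induction j with
  | zero =>
    simp only [mul_zero, zero_add, mul_one]
    rw [pA_two, pB_two]
    exact ⟨⟨2 * pA m, by ring⟩, ⟨2 * pB m, by ring⟩⟩
  | succ j ih =>
    have e : 2 * m * (2 * (j + 1) + 1) = 2 * m * (2 * j + 1) + 2 * (2 * m) := by ring
    rw [e, (p_add _ _).1, (p_add _ _).2, pA_two, pB_two, pA_two, pB_two]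
    obtain ⟨⟨c, hc⟩, ⟨d, hd⟩⟩ := ih
    have hc' : pA (2 * m * (2 * j + 1)) = pA m * c - 1 := by linarith
    rw [hc', hd]
    generalize pA m = a
    generalize pB m = b
    constructor
    · exact ⟨c * (2 * (2 * a ^ 2 - 1) ^ 2 - 1) - (8 * a ^ 3 - 8 * a) +
        2 * d * (2 * (2 * a ^ 2 - 1) * (2 * a * b)), by ring⟩
    · exact ⟨(a * c - 1) * (2 * (2 * a ^ 2 - 1) * (2 * b)) +
        d * (2 * (2 * a ^ 2 - 1) ^ 2 - 1), by ring⟩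

lemma pell_param_pos (z : ℕ) : ∀ v : ℕ, ((v : ℤ) ^ 2 - 2 * (z : ℤ) ^ 2 = -1) →
    ∃ k, (v : ℤ) = pA k + 2 * pB k ∧ (z : ℤ) = pA k + pB k := by
  induction z using Nat.strong_induction_on with
  | _ z ih =>
    intro v h
    by_cases hv : v ≤ 2
    · refine ⟨0, ?_⟩
      rw [pA_zero, pB_zero]
      interval_cases v
      · omega
      · have : (z : ℤ) ^ 2 = 1 := by push_cast at h; linarith
        have hz : (z : ℤ) = 1 := by nlinarith
        simp [hz]
      · push_cast at h; omega
    · have hv3 : (3 : ℤ) ≤ v := by omega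
      have hz0 : (0 : ℤ) ≤ z := by omega
      have h1 : (0 : ℤ) < 3 * v - 4 * z := by nlinarith
      have h2 : (0 : ℤ) < 3 * z - 2 * v := by nlinarith
      have h3 : (z : ℤ) < v := by nlinarith
      obtain ⟨k, hk1, hk2⟩ := ih (3 * z - 2 * v : ℤ).toNat (by omega) (3 * v - 4 * z : ℤ).toNat (by
        rw [Int.toNat_of_nonneg h1.le, Int.toNat_of_nonneg h2.le]; linarith)
      rw [Int.toNat_of_nonneg h1.le] at hk1
      rw [Int.toNat_of_nonneg h2.le] at hk2
      refine ⟨k + 1, ?_⟩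
      rw [pA_succ, pB_succ]
      constructor <;> linarith

lemma pell_param (V Z : ℤ) (h : V ^ 2 - 2 * Z ^ 2 = -1) :
    ∃ k, V = pA k + 2 * pB k ∨ V = -(pA k + 2 * pB k) := by
  obtain ⟨k, hk, -⟩ := pell_param_pos Z.natAbs V.natAbs (by
    rw [Int.natAbs_sq, Int.natAbs_sq]; exact h)
  refine ⟨k, ?_⟩
  omega

/-! ### The sieve modulo 180 -/

/-- Product of the sieving primes. -/
def sieveM : ℤ := 3 * 19 * 29 * 31 * 41 * 73 * 179 * 197

lemma p_180 : sieveM ∣ pA 180 - 1 ∧ sieveM ∣ pB 180 := by decide +kernel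

lemma p_period (q r : ℕ) : sieveM ∣ pA (180 * q + r) - pA r ∧ sieveM ∣ pB (180 * q + r) - pB r := by
  induction q with
  | zero => simp
  | succ q ih =>
    have e : 180 * (q + 1) + r = 180 + (180 * q + r) := by ring
    rw [e, (p_add 180 (180 * q + r)).1, (p_add 180 (180 * q + r)).2]
    obtain ⟨⟨a, ha⟩, ⟨b, hb⟩⟩ := p_180
    obtain ⟨⟨c, hc⟩, ⟨d, hd⟩⟩ := ih
    have ha' : pA 180 = sieveM * a + 1 := by linarith
    have hc' : pA (180 * q + r) = sieveM * c + pA r := by linarith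
    have hd' : pB (180 * q + r) = sieveM * d + pB r := by linarith
    rw [ha', hb, hc', hd']
    constructor
    · exact ⟨a * (sieveM * c + pA r) + c + 2 * b * (sieveM * d + pB r), by ring⟩
    · exact ⟨a * (sieveM * d + pB r) + d + b * (sieveM * c + pA r), by ring⟩

/-- `x` is not a square modulo `p`. -/
def nonSq (p : ℕ) (x : ℤ) : Bool :=
  let c := (x % p).toNat
  (List.range p).all fun y => !(Nat.beq (y * y % p) c)

lemma nonSq_spec (p : ℕ) (hp : 0 < p) (x w : ℤ) (h : nonSq p x = true) : ¬ (p : ℤ) ∣ w ^ 2 - x := by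
  intro hd
  have hp' : (0 : ℤ) < p := by exact_mod_cast hp
  simp only [nonSq, List.all_eq_true, List.mem_range, Bool.not_eq_true'] at h
  have h0 := Int.emod_nonneg w hp'.ne'
  have h1 := Int.emod_lt_of_pos w hp'
  refine Nat.ne_of_beq_eq_false (h (w % p).toNat (by omega)) ?_
  zify
  rw [Int.toNat_of_nonneg h0, Int.toNat_of_nonneg (Int.emod_nonneg _ hp'.ne'), ← Int.mul_emod,
    ← sq]
  exact Int.emod_eq_emod_iff_emod_sub_eq_zero.mpr (Int.emod_eq_zero_of_dvd hd)

def sieveL : List ℕ := [3, 19, 29, 31, 41, 73, 179, 197]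

lemma sieve_plus : ∀ r < 180, r = 178 ∨ r = 179 ∨
    ∃ p ∈ sieveL, nonSq p (10 * ((pA r + 2 * pB r + 4) ^ 2 + 1)) = true := by decide +kernel

lemma sieve_minus : ∀ r < 180, r = 0 ∨ r = 1 ∨
    ∃ p ∈ sieveL, nonSq p (10 * ((-(pA r + 2 * pB r) + 4) ^ 2 + 1)) = true := by decide +kernel

lemma sieveL_spec : ∀ p ∈ sieveL, 0 < p ∧ (p : ℤ) ∣ sieveM := by decide +kernel

/-! ### Jacobi symbols -/

lemma double_mod (N x a b : ℤ) (h : x % N = a) (hb : (2 * a ^ 2 - 1) % N = b) :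
    (2 * x ^ 2 - 1) % N = b := by
  rw [← hb, ← h]
  have h1 : x % N ≡ x [ZMOD N] := Int.mod_modEq x N
  exact (((h1.pow 2).mul_left 2).sub_right 1).symm

lemma pA_pow_succ (s t : ℕ) : pA (s * 2 ^ (t + 1 + 1)) = 2 * pA (s * 2 ^ (t + 1)) ^ 2 - 1 := by
  rw [← pA_two]; congr 1; ring

lemma orbit65 (t : ℕ) :
    (pA (1 * 2 ^ (t + 1)) % 65 = 17 ∧ pA (5 * 2 ^ (t + 1)) % 65 = 57) ∨
    (pA (1 * 2 ^ (t + 1)) % 65 = 57 ∧ pA (5 * 2 ^ (t + 1)) % 65 = 62) ∨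
    (pA (1 * 2 ^ (t + 1)) % 65 = 62 ∧ pA (5 * 2 ^ (t + 1)) % 65 = 17) := by
  induction t with
  | zero => left; decide +kernel
  | succ t ih =>
    rw [pA_pow_succ, pA_pow_succ]
    rcases ih with ⟨h1, h2⟩ | ⟨h1, h2⟩ | ⟨h1, h2⟩
    · exact .inr (.inl ⟨double_mod _ _ _ _ h1 rfl, double_mod _ _ _ _ h2 rfl⟩)
    · exact .inr (.inr ⟨double_mod _ _ _ _ h1 rfl, double_mod _ _ _ _ h2 rfl⟩)
    · exact .inl ⟨double_mod _ _ _ _ h1 rfl, double_mod _ _ _ _ h2 rfl⟩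

lemma orbit305 (t : ℕ) :
    (pA (1 * 2 ^ (t + 1)) % 305 = 17 ∧ pA (3 * 2 ^ (t + 1)) % 305 = 81 ∧
      pA (45 * 2 ^ (t + 1)) % 305 = 206) ∨
    (pA (1 * 2 ^ (t + 1)) % 305 = 272 ∧ pA (3 * 2 ^ (t + 1)) % 305 = 6 ∧
      pA (45 * 2 ^ (t + 1)) % 305 = 81) ∨
    (pA (1 * 2 ^ (t + 1)) % 305 = 42 ∧ pA (3 * 2 ^ (t + 1)) % 305 = 71 ∧
      pA (45 * 2 ^ (t + 1)) % 305 = 6) ∨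
    (pA (1 * 2 ^ (t + 1)) % 305 = 172 ∧ pA (3 * 2 ^ (t + 1)) % 305 = 16 ∧
      pA (45 * 2 ^ (t + 1)) % 305 = 71) ∨
    (pA (1 * 2 ^ (t + 1)) % 305 = 302 ∧ pA (3 * 2 ^ (t + 1)) % 305 = 206 ∧
      pA (45 * 2 ^ (t + 1)) % 305 = 16) := by
  induction t with
  | zero => left; decide +kernel
  | succ t ih =>
    rw [pA_pow_succ, pA_pow_succ, pA_pow_succ]
    rcases ih with ⟨h1, h2, h3⟩ | ⟨h1, h2, h3⟩ | ⟨h1, h2, h3⟩ | ⟨h1, h2, h3⟩ | ⟨h1, h2, h3⟩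
    · exact .inr (.inl ⟨double_mod _ _ _ _ h1 rfl, double_mod _ _ _ _ h2 rfl,
        double_mod _ _ _ _ h3 rfl⟩)
    · exact .inr (.inr (.inl ⟨double_mod _ _ _ _ h1 rfl, double_mod _ _ _ _ h2 rfl,
        double_mod _ _ _ _ h3 rfl⟩))
    · exact .inr (.inr (.inr (.inl ⟨double_mod _ _ _ _ h1 rfl, double_mod _ _ _ _ h2 rfl,
        double_mod _ _ _ _ h3 rfl⟩)))
    · exact .inr (.inr (.inr (.inr ⟨double_mod _ _ _ _ h1 rfl, double_mod _ _ _ _ h2 rfl,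
        double_mod _ _ _ _ h3 rfl⟩)))
    · exact .inl ⟨double_mod _ _ _ _ h1 rfl, double_mod _ _ _ _ h2 rfl,
        double_mod _ _ _ _ h3 rfl⟩

lemma jac_key (N m : ℕ) (hN : N % 4 = 1) (a : ℤ) (hm : pA m % (N : ℤ) = a)
    (hJ : jacobiSym a N = -1) (W : ℤ) : ¬ pA m ∣ W ^ 2 - 4 * (N : ℤ) := by
  intro hd
  obtain ⟨b, hb⟩ := Int.eq_ofNat_of_zero_le (p_pos m).1.le
  have hbodd : Odd b := by
    have h := p_norm m
    rw [hb] at h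
    rw [← Nat.not_even_iff_odd]
    rintro ⟨c, rfl⟩
    push_cast at h
    ring_nf at h
    omega
  rw [hb] at hd hm
  have h1 : jacobiSym (W ^ 2) b = jacobiSym (4 * (N : ℤ)) b :=
    jacobiSym.mod_left' (Int.emod_eq_emod_iff_emod_sub_eq_zero.mpr (Int.emod_eq_zero_of_dvd hd))
  rw [jacobiSym.mul_left, jacobiSym.at_four hbodd, one_mul,
    jacobiSym.quadratic_reciprocity_one_mod_four hN hbodd, jacobiSym.mod_left (b : ℤ) N, hm, hJ,
    jacobiSym.pow_left] at h1
  nlinarith [sq_nonneg (jacobiSym W b)]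

lemma exists_65 (t : ℕ) : ∃ s r a, s * r = 45 ∧ pA (s * 2 ^ (t + 1)) % ((65 : ℕ) : ℤ) = a ∧
    jacobiSym a 65 = -1 := by
  rcases orbit65 t with ⟨h1, h2⟩ | ⟨h1, h2⟩ | ⟨h1, h2⟩
  · exact ⟨1, 45, _, rfl, h1, by norm_num⟩
  · exact ⟨5, 9, _, rfl, h2, by norm_num⟩
  · exact ⟨1, 45, _, rfl, h1, by norm_num⟩

lemma exists_305 (t : ℕ) : ∃ s r a, s * r = 45 ∧ pA (s * 2 ^ (t + 1)) % ((305 : ℕ) : ℤ) = a ∧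
    jacobiSym a 305 = -1 := by
  rcases orbit305 t with ⟨h1, h2, h3⟩ | ⟨h1, h2, h3⟩ | ⟨h1, h2, h3⟩ | ⟨h1, h2, h3⟩ | ⟨h1, h2, h3⟩
  · exact ⟨45, 1, _, rfl, h3, by norm_num⟩
  · exact ⟨3, 15, _, rfl, h2, by norm_num⟩
  · exact ⟨1, 45, _, rfl, h1, by norm_num⟩
  · exact ⟨45, 1, _, rfl, h3, by norm_num⟩
  · exact ⟨1, 45, _, rfl, h1, by norm_num⟩

/-- General form of the final contradiction. -/
lemma no_sol (N : ℕ) (hN : N % 4 = 1)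
    (hex : ∀ t : ℕ, ∃ s r a, s * r = 45 ∧ pA (s * 2 ^ (t + 1)) % (N : ℤ) = a ∧ jacobiSym a N = -1)
    (v c : ℤ) (hv : 10 * ((v + 4) ^ 2 + 1) = 4 * (N : ℤ)) (q : ℕ) (V W : ℤ)
    (hV : V = -v * pA (180 * (q + 1)) + c * pB (180 * (q + 1)))
    (hW : 10 * ((V + 4) ^ 2 + 1) = W ^ 2) : False := by
  obtain ⟨t, w, ⟨w', hw⟩, hq⟩ := Nat.exists_eq_two_pow_mul_odd (Nat.succ_ne_zero q)
  obtain ⟨s, r, a, hsr, ha, hJ⟩ := hex t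
  have hr : Odd r := by
    have : Odd (s * r) := by rw [hsr]; decide
    exact (Nat.odd_mul.mp this).2
  have hrw : Odd (r * w) := hr.mul ⟨w', hw⟩
  obtain ⟨j, hj⟩ := hrw
  have hn : 180 * (q + 1) = 2 * (s * 2 ^ (t + 1)) * (2 * j + 1) := by
    rw [← hj]
    have : q + 1 = 2 ^ t * w := hq
    rw [this, pow_succ]
    have : 2 * (s * (2 ^ t * 2)) * (r * w) = 4 * (s * r) * (2 ^ t * w) := by ring
    rw [this, hsr]
  obtain ⟨h1, h2⟩ := p_odd_mul (s * 2 ^ (t + 1)) j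
  rw [← hn] at h1 h2
  refine jac_key N _ hN a ha hJ W ?_
  have h3 : pA (s * 2 ^ (t + 1)) ∣ V - v := by
    have : V - v = -v * (pA (180 * (q + 1)) + 1) + c * pB (180 * (q + 1)) := by rw [hV]; ring
    rw [this]
    exact dvd_add (h1.mul_left _) (h2.mul_left _)
  rw [← hW, ← hv]
  have : 10 * ((V + 4) ^ 2 + 1) - 10 * ((v + 4) ^ 2 + 1) = (10 * (V + v + 8)) * (V - v) := by ring
  rw [this]
  exact h3.mul_left _

lemma sieve_contra (p : ℕ) (hp : p ∈ sieveL) (e : ℤ) (q r : ℕ) (W : ℤ)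
    (hns : nonSq p (10 * ((e * (pA r + 2 * pB r) + 4) ^ 2 + 1)) = true)
    (hW : 10 * ((e * (pA (180 * q + r) + 2 * pB (180 * q + r)) + 4) ^ 2 + 1) = W ^ 2) : False := by
  obtain ⟨hp0, hpM⟩ := sieveL_spec p hp
  refine nonSq_spec p hp0 _ W hns ?_
  obtain ⟨h1, h2⟩ := p_period q r
  have h3 := hpM.trans h1
  have h4 := hpM.trans h2
  rw [← hW]
  obtain ⟨c, hc⟩ := h3
  obtain ⟨d, hd⟩ := h4
  have hc' : pA (180 * q + r) = p * c + pA r := by linarith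
  have hd' : pB (180 * q + r) = p * d + pB r := by linarith
  rw [hc', hd']
  exact ⟨10 * e * (c + 2 * d) * (e * (p * c + pA r + 2 * (p * d + pB r)) +
    e * (pA r + 2 * pB r) + 8), by ring⟩

lemma V_cases (V Y Z : ℤ) (h1 : (V + 4) ^ 2 - 10 * Y ^ 2 = -1) (h2 : V ^ 2 - 2 * Z ^ 2 = -1) :
    V = -1 ∨ V = -7 := by
  have hW : 10 * ((V + 4) ^ 2 + 1) = (10 * Y) ^ 2 := by linarith
  obtain ⟨k, hk⟩ := pell_param V Z h2
  have hkd : k = 180 * (k / 180) + k % 180 := (Nat.div_add_mod k 180).symm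
  have hr : k % 180 < 180 := Nat.mod_lt _ (by norm_num)
  generalize k / 180 = q at hkd
  generalize k % 180 = r at hkd hr
  subst hkd
  rcases hk with hk | hk
  · exfalso
    rcases sieve_plus r hr with rfl | rfl | ⟨p, hp, hns⟩
    · refine no_sol 305 rfl exists_305 7 10 (by norm_num) q V _ ?_ hW
      have e : 180 * (q + 1) = 180 * q + 178 + 1 + 1 := by ring
      rw [e, hk]
      generalize 180 * q + 178 = n
      simp only [pA_succ, pB_succ]; ring
    · refine no_sol 65 rfl exists_65 1 2 (by norm_num) q V _ ?_ hW
      have e : 180 * (q + 1) = 180 * q + 179 + 1 := by ring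
      rw [e, hk]
      generalize 180 * q + 179 = n
      rw [pA_succ, pB_succ]; ring
    · refine sieve_contra p hp 1 q r (10 * Y) (by rw [one_mul]; exact hns) ?_
      rw [one_mul, ← hk]; exact hW
  · rcases sieve_minus r hr with rfl | rfl | ⟨p, hp, hns⟩
    · rcases q with _ | q
      · left; rw [hk]; decide +kernel
      · exfalso
        refine no_sol 65 rfl exists_65 1 (-2) (by norm_num) q V _ ?_ hW
        rw [hk, add_zero]; ring
    · rcases q with _ | q
      · right; rw [hk]; decide +kernel
      · exfalso
        refine no_sol 305 rfl exists_305 7 (-10) (by norm_num) q V _ ?_ hW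
        rw [hk, pA_succ, pB_succ]; ring
    · exfalso
      refine sieve_contra p hp (-1) q r (10 * Y) (by rw [neg_one_mul]; exact hns) ?_
      rw [neg_one_mul, ← hk]; exact hW

theorem simultaneous_pell_one (X Y Z : ℤ)
    (h1 : (X + 2) ^ 2 - 10 * Y ^ 2 = -1) (h2 : (X - 2) ^ 2 - 2 * Z ^ 2 = -1) :
    (X = 1 ∧ (Y = 1 ∨ Y = -1) ∧ (Z = 1 ∨ Z = -1)) ∨
    (X = -5 ∧ (Y = 1 ∨ Y = -1) ∧ (Z = 5 ∨ Z = -5)) := by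
  rcases V_cases (X - 2) Y Z (by rw [← h1]; ring) h2 with h | h
  · left
    obtain rfl : X = 1 := by linarith
    refine ⟨rfl, sq_eq_sq_iff_eq_or_eq_neg.mp ?_, sq_eq_sq_iff_eq_or_eq_neg.mp ?_⟩ <;> linarith
  · right
    obtain rfl : X = -5 := by linarith
    refine ⟨rfl, sq_eq_sq_iff_eq_or_eq_neg.mp ?_, sq_eq_sq_iff_eq_or_eq_neg.mp ?_⟩ <;> linarith
end

section
/- The only solutions to the simultaneous Diophantine equations X^2 - 2Y^2 = -1 and X^2 - 10Z^2 = -9 in integers are (X, Y, Z) = (±1, ±1, ±1) and (±41, ±29, ±13). -/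
/-- Lucas numbers. -/
def luc (n : ℕ) : ℤ := 2 * (Nat.fib (n + 1) : ℤ) - Nat.fib n

theorem luc_zero : luc 0 = 2 := by simp [luc]
theorem luc_one : luc 1 = 1 := by simp [luc]
theorem luc_add_two (n : ℕ) : luc (n + 2) = luc n + luc (n + 1) := by
  unfold luc
  have h1 := Nat.fib_add_two (n := n)
  have h2 := Nat.fib_add_two (n := n + 1)
  rw [show n + 2 + 1 = n + 1 + 2 from rfl, h2, h1]
  push_cast
  ring

theorem luc_pos (n : ℕ) : 0 < luc n := by
  induction n using Nat.twoStepInduction with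
  | zero => simp [luc_zero]
  | one => simp [luc_one]
  | more n h1 h2 => rw [luc_add_two]; omega

theorem luc_real (n : ℕ) : (luc n : ℝ) = Real.goldenRatio ^ n + Real.goldenConj ^ n := by
  induction n using Nat.twoStepInduction with
  | zero => simp [luc_zero]; norm_num
  | one => simp [luc_one]
  | more n h1 h2 =>
    rw [luc_add_two]
    push_cast
    rw [h1, h2, pow_add _ n 2, pow_add _ n 2, Real.goldenRatio_sq, Real.goldenConj_sq]
    ring

theorem luc_mul (a q : ℕ) :
    luc (a + 2 * q) + (-1) ^ q * luc a = luc q * luc (a + q) := by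
  have h : ((luc (a + 2 * q) + (-1) ^ q * luc a : ℤ) : ℝ) = ((luc q * luc (a + q) : ℤ) : ℝ) := by
    push_cast
    rw [luc_real, luc_real, luc_real, luc_real, ← Real.goldenRatio_mul_goldenConj, mul_pow]
    ring
  exact_mod_cast h

theorem luc_mul_even (a q : ℕ) (hq : Even q) :
    luc (a + 2 * q) + luc a = luc q * luc (a + q) := by
  have := luc_mul a q
  rwa [hq.neg_one_pow, one_mul] at this

theorem luc_dvd (k : ℕ) (hk : Even k) (j : ℕ) : luc k ∣ luc (k * (2 * j + 1)) := by
  induction j with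
  | zero => simp
  | succ j ih =>
    have h := luc_mul_even (k * (2 * j + 1)) k hk
    have e : k * (2 * (j + 1) + 1) = k * (2 * j + 1) + 2 * k := by ring
    rw [e, eq_sub_of_add_eq h]
    exact dvd_sub (dvd_mul_right _ _) ih

/-- periodicity -/
theorem luc_period (p : ℤ) (m : ℕ) (h0 : luc m ≡ 2 [ZMOD p]) (h1 : luc (m + 1) ≡ 1 [ZMOD p])
    (a : ℕ) : luc (a + m) ≡ luc a [ZMOD p] := by
  induction a using Nat.twoStepInduction with
  | zero => simpa [luc_zero] using h0
  | one => rw [add_comm 1 m, luc_one]; exact h1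
  | more n h1 h2 =>
    rw [show n + 2 + m = (n + m) + 2 by ring, luc_add_two, luc_add_two,
      show n + m + 1 = n + 1 + m by ring]
    exact h1.add h2

theorem luc_mod (p : ℤ) (m : ℕ) (h0 : luc m ≡ 2 [ZMOD p]) (h1 : luc (m + 1) ≡ 1 [ZMOD p])
    (a : ℕ) : luc a ≡ luc (a % m) [ZMOD p] := by
  have key : ∀ t b, luc (b + m * t) ≡ luc b [ZMOD p] := by
    intro t
    induction t with
    | zero => intro b; simp
    | succ t ih =>
      intro b
      rw [show b + m * (t + 1) = (b + m * t) + m by ring]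
      exact (luc_period p m h0 h1 _).trans (ih b)
  have := key (a / m) (a % m)
  rwa [Nat.mod_add_div] at this

/-- Lucas pairs modulo `p`. -/
def lucPair (p : ℕ) : ℕ → ℕ × ℕ
  | 0 => (2 % p, 1 % p)
  | n + 1 => match lucPair p n with
    | (a, b) => (b, (a + b) % p)

theorem lucPair_spec (p n : ℕ) :
    ((lucPair p n).1 : ℤ) ≡ luc n [ZMOD p] ∧ ((lucPair p n).2 : ℤ) ≡ luc (n + 1) [ZMOD p] := by
  induction n with
  | zero =>
    simp only [lucPair, luc_zero]
    push_cast
    exact ⟨Int.mod_modEq _ _, Int.mod_modEq _ _⟩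
  | succ n ih =>
    refine ⟨ih.2, ?_⟩
    simp only [lucPair]
    rw [luc_add_two]
    push_cast
    exact (Int.mod_modEq _ _).trans (ih.1.add ih.2)

def sqb (p c : ℕ) : Bool := (List.range p).any fun s => (s * s + 5) % p == c

def ok (p m r : ℕ) : Bool := sqb p (2 * (lucPair p (r % m)).1 % p)

theorem ok_of (p m : ℕ) (hp : 0 < p) (hm : lucPair p m = (2, 1)) (X : ℤ) (N M : ℕ)
    (hM : m ∣ M) (h : X ^ 2 = 2 * luc N - 5) : ok p m (N % M) = true := by
  have hs := lucPair_spec p m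
  rw [hm] at hs
  have h2 := luc_mod p m hs.1.symm hs.2.symm N
  have h3 := (lucPair_spec p (N % m)).1.trans h2.symm
  unfold ok sqb
  rw [Nat.mod_mod_of_dvd _ hM, List.any_eq_true]
  have hpz : (0 : ℤ) < p := by exact_mod_cast hp
  refine ⟨(X % p).toNat, ?_, ?_⟩
  · rw [List.mem_range]
    have := Int.emod_lt_of_pos X hpz
    have := Int.emod_nonneg X hpz.ne'
    omega
  · rw [beq_iff_eq]
    have h4 : (((X % p).toNat * (X % p).toNat + 5 : ℕ) : ℤ) ≡
        ((2 * (lucPair p (N % m)).1 : ℕ) : ℤ) [ZMOD p] := by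
      push_cast
      rw [Int.toNat_of_nonneg (Int.emod_nonneg X hpz.ne')]
      have e : X * X + 5 = 2 * luc N := by linarith [sq X]
      have := (((Int.mod_modEq X p).mul (Int.mod_modEq X p)).add_right 5)
      rw [e] at this
      exact this.trans (h3.mul_left 2).symm
    exact (Int.natCast_modEq_iff.mp h4)

def plist : List (ℕ × ℕ) := [(13, 28), (11, 10), (43, 88), (41, 40), (89, 44), (61, 60), (71, 70), (83, 168), (199, 22), (421, 84), (661, 220), (2311, 2310)]

def sieveB : Bool := (List.range 4620).all fun r =>
  r % 2 == 0 || r == 1 || r == 7 || r == 4613 || r == 4619 ||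
    plist.any fun x => ! ok x.1 x.2 (2 * r)

theorem sieveB_true : sieveB = true := by decide +kernel

theorem plist_ok : ∀ x ∈ plist, 0 < x.1 ∧ x.2 ∣ 9240 ∧ lucPair x.1 x.2 = (2, 1) := by decide +kernel

theorem sieve (X : ℤ) (n : ℕ) (hn : n % 2 = 1) (h : X ^ 2 = 2 * luc (2 * n) - 5) :
    n % 4620 = 1 ∨ n % 4620 = 7 ∨ n % 4620 = 4613 ∨ n % 4620 = 4619 := by
  have h1 := sieveB_true
  unfold sieveB at h1
  rw [List.all_eq_true] at h1
  have h2 := h1 (n % 4620) (List.mem_range.mpr (Nat.mod_lt _ (by norm_num)))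
  have h3 : (plist.any fun x => ! ok x.1 x.2 (2 * (n % 4620))) = false := by
    rw [List.any_eq_false]
    intro x hx
    obtain ⟨a, b, c⟩ := plist_ok x hx
    have := ok_of x.1 x.2 a c X (2 * n) 9240 b h
    rw [show 2 * n % 9240 = 2 * (n % 4620) by omega] at this
    simp [this]
  rw [h3] at h2
  simp only [Bool.or_eq_true, beq_iff_eq, Bool.false_eq_true, or_false] at h2
  omega

theorem jac (a b : ℕ) (ha : a % 4 = 3) (hb : b % 2 = 1) :
    jacobiSym (-(a : ℤ)) b = jacobiSym b a := by
  have hbo : Odd b := Nat.odd_iff.mpr hb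
  have hao : Odd a := Nat.odd_iff.mpr (by omega)
  rw [jacobiSym.neg _ hbo]
  rcases (by omega : b % 4 = 1 ∨ b % 4 = 3) with h | h
  · rw [ZMod.χ₄_nat_one_mod_four h, one_mul,
      jacobiSym.quadratic_reciprocity_one_mod_four' hao h]
  · rw [ZMod.χ₄_nat_three_mod_four h, jacobiSym.quadratic_reciprocity_three_mod_four ha h]
    ring

theorem luc_odd (k : ℕ) (hk : k % 3 ≠ 0) : luc k % 2 = 1 := by
  have h := luc_mod 2 3 (by decide) (by decide) k
  have : k % 3 = 1 ∨ k % 3 = 2 := by omega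
  rcases this with e | e <;> rw [e] at h
  · exact h.trans (by decide : luc 1 ≡ 1 [ZMOD 2])
  · exact h.trans (by decide : luc 2 ≡ 1 [ZMOD 2])

theorem no_sq (k a : ℕ) (X : ℤ) (hk : k % 3 ≠ 0) (ha : a % 4 = 3) (c : ℤ)
    (hc : luc k ≡ c [ZMOD a]) (hj : jacobiSym c a = -1) (hd : luc k ∣ X ^ 2 + a) : False := by
  obtain ⟨b, hb⟩ := Int.eq_ofNat_of_zero_le (luc_pos k).le
  have ho := luc_odd k hk
  rw [hb] at hc hd ho
  have h1 : jacobiSym (-(a : ℤ)) b = -1 := by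
    rw [jac a b ha (by omega), ← hj]
    exact jacobiSym.mod_left' hc
  apply ZMod.nonsquare_of_jacobiSym_eq_neg_one h1
  refine ⟨(X : ZMod b), ?_⟩
  have := (ZMod.intCast_zmod_eq_zero_iff_dvd _ b).mpr hd
  push_cast at this ⊢
  linear_combination -this

/-- two-sided congruence -/
theorem two_sided (X : ℤ) (n c q k j : ℕ) (h : X ^ 2 = 2 * luc (2 * n) - 5) (hk : Even k)
    (hq : q = k * (2 * j + 1)) (hc : 2 * c ≤ q) (hn : n = q + c ∨ n + c = q) :
    luc k ∣ X ^ 2 + (2 * luc (2 * c) + 5) := by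
  have hqe : Even q := by rw [hq]; exact hk.mul_right _
  have hd : luc k ∣ luc q := by rw [hq]; exact luc_dvd k hk j
  have h2 : luc q ∣ luc (2 * n) + luc (2 * c) := by
    rcases hn with hn | hn
    · have := luc_mul_even (2 * c) q hqe
      rw [show 2 * n = 2 * c + 2 * q by omega, this]
      exact dvd_mul_right _ _
    · obtain ⟨r, hr⟩ := Nat.exists_eq_add_of_le hc
      have hre : Even r := by
        rw [hr] at hqe
        exact (Nat.even_add.mp hqe).mp (even_two_mul c)
      have := luc_mul_even (2 * c) r hre
      rw [show 2 * n = 2 * c + 2 * r by omega, this, ← hr]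
      exact dvd_mul_left _ _
  rw [h, show 2 * luc (2 * n) - 5 + (2 * luc (2 * c) + 5) = 2 * (luc (2 * n) + luc (2 * c)) by ring]
  exact (hd.trans h2).mul_left 2

theorem pow_two_mod (t : ℕ) : 2 ^ t % 3 ≠ 0 := by
  induction t with
  | zero => decide
  | succ t ih => rw [pow_succ]; omega

theorem case_one (X : ℤ) (n q : ℕ) (h : X ^ 2 = 2 * luc (2 * n) - 5) (hq0 : 0 < q)
    (hq : 4620 ∣ q) (hn : n = q + 1 ∨ n + 1 = q) : False := by
  obtain ⟨t, u, hu, rfl⟩ := Nat.exists_eq_two_pow_mul_odd hq0.ne'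
  have ht : t ≠ 0 := by
    rintro rfl
    rw [pow_zero, one_mul] at hq
    rw [Nat.odd_iff] at hu
    omega
  obtain ⟨s, rfl⟩ := Nat.exists_eq_add_of_le' (Nat.one_le_iff_ne_zero.mpr ht)
  have h5 : 5 ∣ u := by
    have : Nat.Coprime 5 (2 ^ (s + 1)) := Nat.Coprime.pow_right _ (by norm_num)
    exact this.dvd_of_dvd_mul_left ((by norm_num : 5 ∣ 4620).trans hq)
  obtain ⟨g, rfl⟩ := h5
  have hg : Odd g := (Nat.odd_mul.mp hu).2
  obtain ⟨j, rfl⟩ := hg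
  have hq1 : 4620 ≤ 2 ^ (s + 1) * (5 * (2 * j + 1)) := Nat.le_of_dvd hq0 hq
  have hp := pow_two_mod s
  have hd := two_sided X n 1 _ (2 ^ (s + 1) * 5) j h (by rw [pow_succ]; exact ⟨2 ^ s * 5, by ring⟩)
    (by ring) (by omega) hn
  refine no_sq (2 ^ (s + 1) * 5) 11 X (by rw [pow_succ]; omega) (by norm_num) 2 ?_ (by norm_num) ?_
  · have := luc_mod 11 10 (by decide) (by decide) (2 ^ (s + 1) * 5)
    rw [show 2 ^ (s + 1) * 5 % 10 = 0 by rw [pow_succ]; omega, luc_zero] at this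
    exact_mod_cast this
  · have e : 2 * luc (2 * 1) + 5 = ((11 : ℕ) : ℤ) := by decide
    rwa [e] at hd

theorem pow_two_mod_nine (t : ℕ) : ∃ h, (h = 11 ∨ h = 55 ∨ h = 77) ∧
    (2 ^ t * 2 * h % 18 = 2 ∨ 2 ^ t * 2 * h % 18 = 16) := by
  have : 2 ^ t % 9 = 1 ∨ 2 ^ t % 9 = 2 ∨ 2 ^ t % 9 = 4 ∨ 2 ^ t % 9 = 8 ∨ 2 ^ t % 9 = 7 ∨
      2 ^ t % 9 = 5 := by
    induction t with
    | zero => decide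
    | succ t ih => rw [pow_succ]; omega
  rcases this with e | e | e | e | e | e
  · exact ⟨55, by omega, by omega⟩
  · exact ⟨77, by omega, by omega⟩
  · exact ⟨11, by omega, by omega⟩
  · exact ⟨55, by omega, by omega⟩
  · exact ⟨77, by omega, by omega⟩
  · exact ⟨11, by omega, by omega⟩

theorem case_seven (X : ℤ) (n q : ℕ) (h : X ^ 2 = 2 * luc (2 * n) - 5) (hq0 : 0 < q)
    (hq : 4620 ∣ q) (hn : n = q + 7 ∨ n + 7 = q) : False := by
  obtain ⟨t, u, hu, rfl⟩ := Nat.exists_eq_two_pow_mul_odd hq0.ne'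
  have ht : 2 ≤ t := by
    by_contra hlt
    have : t = 0 ∨ t = 1 := by omega
    rw [Nat.odd_iff] at hu
    rcases this with rfl | rfl
    · rw [pow_zero, one_mul] at hq
      omega
    · rw [pow_one] at hq
      omega
  obtain ⟨s, rfl⟩ := Nat.exists_eq_add_of_le' ht
  obtain ⟨w, hw, hm⟩ := pow_two_mod_nine (s + 1)
  have hwu : w ∣ u := by
    have h0 : Nat.Coprime 385 (2 ^ (s + 2)) := Nat.Coprime.pow_right _ (by norm_num)
    have h1 : 385 ∣ u := h0.dvd_of_dvd_mul_left ((by norm_num : 385 ∣ 4620).trans hq)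
    rcases hw with rfl | rfl | rfl <;> exact Nat.dvd_trans (by norm_num) h1
  obtain ⟨g, rfl⟩ := hwu
  have hg : Odd g := (Nat.odd_mul.mp hu).2
  obtain ⟨j, rfl⟩ := hg
  have hq1 : 4620 ≤ 2 ^ (s + 2) * (w * (2 * j + 1)) := Nat.le_of_dvd hq0 hq
  have hd := two_sided X n 7 _ (2 ^ (s + 1) * 2 * w) j h ⟨2 ^ (s + 1) * w, by ring⟩
    (by ring) (by omega) hn
  have h44 : 2 ^ (s + 1) * 2 * w % 44 = 0 := by
    rw [pow_succ]
    rcases hw with rfl | rfl | rfl <;> omega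
  generalize 2 ^ (s + 1) * 2 * w = k at *
  have h89 := luc_mod 89 44 (by decide) (by decide) k
  have h19 := luc_mod 19 18 (by decide) (by decide) k
  rw [h44] at h89
  have h19' : luc k ≡ 3 [ZMOD 19] := by
    rcases hm with e | e <;> rw [e] at h19 <;> exact h19.trans (by decide)
  have h89' : luc k ≡ 2 [ZMOD 89] := h89
  refine no_sq k 1691 X (by omega) (by norm_num) 269 ?_ (by norm_num) ?_
  · unfold Int.ModEq at *
    push_cast
    omega
  · have e : 2 * luc (2 * 7) + 5 = ((1691 : ℕ) : ℤ) := by decide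
    rwa [e] at hd

theorem descent (Z : ℕ) : ∀ Y : ℕ, (Y : ℤ) ^ 2 + 4 = 5 * (Z : ℤ) ^ 2 →
    ∃ j : ℕ, (Y : ℤ) = luc (2 * j + 1) ∧ (Z : ℤ) = Nat.fib (2 * j + 1) := by
  induction Z using Nat.strong_induction_on with
  | _ Z ih =>
    intro Y h
    rcases Nat.lt_or_ge Z 2 with hZ | hZ
    · have hZ1 : Z = 1 := by
        rcases (by omega : Z = 0 ∨ Z = 1) with rfl | rfl
        · exfalso
          push_cast at h
          nlinarith [sq_nonneg (Y : ℤ)]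
        · rfl
      subst hZ1
      have hY : (Y : ℤ) ^ 2 = 1 := by push_cast at h; linarith
      refine ⟨0, ?_, by simp⟩
      rw [mul_zero, zero_add, luc_one]
      nlinarith [Int.natCast_nonneg Y]
    · have hZ' : (2 : ℤ) ≤ Z := by exact_mod_cast hZ
      have hY0 : (0 : ℤ) ≤ Y := Int.natCast_nonneg Y
      have hlt : (Z : ℤ) < Y := by nlinarith
      have hlt2 : (Y : ℤ) < 3 * Z := by nlinarith
      have hlt3 : 5 * (Z : ℤ) < 3 * Y := by nlinarith
      have hpar : (Y : ℤ) % 2 = (Z : ℤ) % 2 := by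
        have h3 : ((Y : ℤ) ^ 2 + 4) % 2 = (5 * (Z : ℤ) ^ 2) % 2 := by rw [h]
        rcases Int.emod_two_eq_zero_or_one (Y : ℤ) with a | a <;>
          rcases Int.emod_two_eq_zero_or_one (Z : ℤ) with b | b <;>
          simp [a, b, pow_two, Int.add_emod, Int.mul_emod] at h3 ⊢
      obtain ⟨z, hz⟩ : ∃ z : ℕ, 3 * (Z : ℤ) - Y = 2 * z := ⟨((3 * (Z : ℤ) - Y) / 2).toNat, by omega⟩
      obtain ⟨y, hy⟩ : ∃ y : ℕ, 3 * (Y : ℤ) - 5 * Z = 2 * y :=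
        ⟨((3 * (Y : ℤ) - 5 * Z) / 2).toNat, by omega⟩
      have hYe : (Y : ℤ) = 3 * Z - 2 * z := by linarith
      have hye : (y : ℤ) = 2 * Z - 3 * z := by linarith
      obtain ⟨j, hj1, hj2⟩ := ih z (by omega) y (by
        rw [hYe] at h
        rw [hye]
        linear_combination h)
      refine ⟨j + 1, ?_, ?_⟩
      · have e1 := luc_add_two (2 * j + 1)
        have e2 : 2 * luc (2 * j + 2) = luc (2 * j + 1) + 5 * (Nat.fib (2 * j + 1) : ℤ) := by
          unfold luc
          rw [Nat.fib_add_two (n := 2 * j + 1), Nat.fib_add_two (n := 2 * j)]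
          push_cast
          ring
        rw [show 2 * (j + 1) + 1 = 2 * j + 1 + 2 by ring, e1]
        rw [show 2 * j + 1 + 1 = 2 * j + 2 from rfl]
        linarith
      · rw [show 2 * (j + 1) + 1 = 2 * j + 1 + 2 by ring, Nat.fib_add_two]
        have e3 : luc (2 * j + 1) = 2 * (Nat.fib (2 * j + 1 + 1) : ℤ) - Nat.fib (2 * j + 1) := rfl
        push_cast
        linarith

theorem index_eq (X : ℤ) (n : ℕ) (hn : n % 2 = 1) (h : X ^ 2 = 2 * luc (2 * n) - 5) :
    n = 1 ∨ n = 7 := by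
  by_contra hne
  rcases sieve X n hn h with e | e | e | e
  · exact case_one X n (n - 1) h (by omega) (by omega) (by omega)
  · exact case_seven X n (n - 7) h (by omega) (by omega) (by omega)
  · exact case_seven X n (n + 7) h (by omega) (by omega) (by omega)
  · exact case_one X n (n + 1) h (by omega) (by omega) (by omega)

theorem simultaneous_pell_two (X Y Z : ℤ)
    (h1 : X ^ 2 - 2 * Y ^ 2 = -1) (h2 : X ^ 2 - 10 * Z ^ 2 = -9) :
    ((X = 1 ∨ X = -1) ∧ (Y = 1 ∨ Y = -1) ∧ (Z = 1 ∨ Z = -1)) ∨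
    ((X = 41 ∨ X = -41) ∧ (Y = 29 ∨ Y = -29) ∧ (Z = 13 ∨ Z = -13)) := by
  obtain ⟨j, hj1, -⟩ := descent Z.natAbs Y.natAbs (by
    rw [Int.natAbs_sq, Int.natAbs_sq]; linarith)
  have hY2 : Y ^ 2 = luc (2 * j + 1) ^ 2 := by rw [← hj1, Int.natAbs_sq]
  have hl := luc_mul 0 (2 * j + 1)
  rw [Odd.neg_one_pow ⟨j, rfl⟩, luc_zero, zero_add, zero_add] at hl
  have hX : X ^ 2 = 2 * luc (2 * (2 * j + 1)) - 5 := by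
    rw [← sq] at hl
    linarith
  have key : ∀ a b : ℤ, a ^ 2 = b ^ 2 → a = b ∨ a = -b := fun a b hab => sq_eq_sq_iff_eq_or_eq_neg.mp hab
  rcases index_eq X _ (by omega) hX with e | e
  · rw [e, luc_one] at hY2
    exact Or.inl ⟨key _ _ (by linarith), key _ _ hY2, key _ _ (by linarith)⟩
  · have e7 : luc 7 = 29 := by decide
    rw [e, e7] at hY2
    exact Or.inr ⟨key _ _ (by linarith), key _ _ hY2, key _ _ (by linarith)⟩
end

section
/- There are no odd integers X ≥ 5 and integer P with (X^2 - 5)^2/4 - 5P^2 = 4; equivalently, there is no odd X ≥ 5 and integer Q with (X^2 - 1)(X^2 - 9) = 5 Q^2 and Q even. -/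
/-- Move a prime factor into one of two coprime factors. -/
lemma split_prime {p a b N : ℕ} (hp : p.Prime) (hab : a.Coprime b) (h : a * b = p * N) :
    (∃ a', a = p * a' ∧ a' * b = N ∧ a'.Coprime b) ∨
    (∃ b', b = p * b' ∧ a * b' = N ∧ a.Coprime b') := by
  have hd : p ∣ a * b := ⟨N, h⟩
  rcases (Nat.Prime.dvd_mul hp).1 hd with ⟨a', rfl⟩ | ⟨b', rfl⟩
  · left
    refine ⟨a', rfl, ?_, Nat.Coprime.coprime_mul_left hab⟩
    apply Nat.eq_of_mul_eq_mul_left hp.pos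
    rw [← h]; ring
  · right
    refine ⟨b', rfl, ?_, Nat.Coprime.coprime_mul_left_right hab⟩
    apply Nat.eq_of_mul_eq_mul_left hp.pos
    rw [← h]; ring

lemma split_pow {a b c k : ℕ} (hk : k ≠ 0) (hab : a.Coprime b) (h : a * b = c ^ k) :
    ∃ x y, a = x ^ k ∧ b = y ^ k ∧ c = x * y := by
  obtain ⟨x, hx⟩ := exists_eq_pow_of_mul_eq_pow (by rw [Nat.isUnit_iff]; exact hab) h
  obtain ⟨y, hy⟩ := exists_eq_pow_of_mul_eq_pow (a := b) (b := a)
    (by rw [Nat.isUnit_iff]; exact hab.symm) (by rw [mul_comm]; exact h)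
  refine ⟨x, y, hx, hy, ?_⟩
  apply Nat.pow_left_injective (n := k) hk
  simp only
  rw [mul_pow, ← hx, ← hy, h]

lemma split_five {a b e : ℕ} (hab : a.Coprime b) (h : a * b = 5 * e ^ 2) :
    ∃ f g, e = f * g ∧ ((a = 5 * f ^ 2 ∧ b = g ^ 2) ∨ (a = g ^ 2 ∧ b = 5 * f ^ 2)) := by
  rcases split_prime Nat.prime_five hab h with ⟨a', rfl, h1, h2⟩ | ⟨b', rfl, h1, h2⟩
  · obtain ⟨x, y, rfl, rfl, rfl⟩ := split_pow two_ne_zero h2 h1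
    exact ⟨x, y, rfl, Or.inl ⟨rfl, rfl⟩⟩
  · obtain ⟨x, y, rfl, rfl, rfl⟩ := split_pow two_ne_zero h2 h1
    exact ⟨y, x, mul_comm _ _, Or.inr ⟨rfl, rfl⟩⟩

lemma split_six {a b e : ℕ} (hab : a.Coprime b) (h : a * b = 6 * e ^ 4) :
    ∃ x y, e = x * y ∧ (a + b = x ^ 4 + 6 * y ^ 4 ∨ a + b = 2 * x ^ 4 + 3 * y ^ 4) := by
  have h' : a * b = 2 * (3 * e ^ 4) := by rw [h]; ring
  rcases split_prime Nat.prime_two hab h' with ⟨a', rfl, h1, h2⟩ | ⟨b', rfl, h1, h2⟩ <;>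
  rcases split_prime Nat.prime_three h2 h1 with ⟨a'', rfl, h3, h4⟩ | ⟨b'', rfl, h3, h4⟩ <;>
  obtain ⟨x, y, rfl, rfl, rfl⟩ := split_pow four_ne_zero h4 h3
  · exact ⟨y, x, mul_comm _ _, Or.inl (by ring)⟩
  · exact ⟨x, y, rfl, Or.inr (by ring)⟩
  · exact ⟨y, x, mul_comm _ _, Or.inr (by ring)⟩
  · exact ⟨x, y, rfl, Or.inl (by ring)⟩

lemma coprime_of {a b : ℕ} (h : ∀ p : ℕ, p.Prime → p ∣ a → p ∣ b → False) : a.Coprime b := by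
  by_contra hc
  obtain ⟨p, hp, h1, h2⟩ := Nat.Prime.not_coprime_iff_dvd.1 hc
  exact h p hp h1 h2

lemma not_dvd_both {a b p : ℕ} (h : a.Coprime b) (hp : p.Prime) (h1 : p ∣ a) (h2 : p ∣ b) :
    False := Nat.Prime.not_coprime_iff_dvd.2 ⟨p, hp, h1, h2⟩ h

lemma parity_aux {d w c : ℕ} (hw : w.Coprime d) (hc : c ^ 2 = w ^ 2 + 10 * d ^ 2) :
    w % 2 = 1 ∧ d % 2 = 0 ∧ c % 2 = 1 := by
  have hnot : ¬ (w % 2 = 0 ∧ d % 2 = 0) := fun ⟨h1, h2⟩ =>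
    not_dvd_both hw Nat.prime_two (Nat.dvd_of_mod_eq_zero h1) (Nat.dvd_of_mod_eq_zero h2)
  have h8 : c ^ 2 % 8 = (w ^ 2 + 10 * d ^ 2) % 8 := by rw [hc]
  have : ∀ c w d : Fin 8, (c.val ^ 2 % 8 = (w.val ^ 2 + 10 * d.val ^ 2) % 8) →
      ¬ (w.val % 2 = 0 ∧ d.val % 2 = 0) →
      w.val % 2 = 1 ∧ d.val % 2 = 0 ∧ c.val % 2 = 1 := by decide
  have h := this ⟨c % 8, Nat.mod_lt _ (by norm_num)⟩ ⟨w % 8, Nat.mod_lt _ (by norm_num)⟩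
    ⟨d % 8, Nat.mod_lt _ (by norm_num)⟩
  simp only at h
  have h1 := h (by simpa [Nat.pow_mod, Nat.add_mod, Nat.mul_mod] using h8) (by omega)
  omega

lemma step1 {d w c v : ℕ} (hd : 0 < d) (hw : w.Coprime d)
    (hc : c ^ 2 = w ^ 2 + 10 * d ^ 2) (hv : v ^ 2 = w ^ 2 + 15 * d ^ 2) :
    ∃ f g : ℕ, d = 2 * (f * g) ∧ v = 5 * f ^ 2 + g ^ 2 ∧ c.Coprime v ∧ f.Coprime g ∧
      (f + g) % 2 = 1 ∧ (25 * ((f:ℤ) ^ 2 - g ^ 2) ^ 2 = w ^ 2 + 24 * g ^ 4) := by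
  obtain ⟨p1, p2, p3⟩ := parity_aux hw hc
  have p4 : v % 2 = 1 := by
    have : v ^ 2 % 2 = (w ^ 2 + 15 * d ^ 2) % 2 := by rw [hv]
    rcases Nat.mod_two_eq_zero_or_one v with h | h
    · simp [Nat.pow_mod, Nat.add_mod, Nat.mul_mod, h, p1, p2] at this
    · exact h
  have hcv : c < v := by
    apply lt_of_pow_lt_pow_left₀ 2 (Nat.zero_le _)
    nlinarith
  obtain ⟨e, rfl⟩ : ∃ e, d = 2 * e := ⟨d / 2, by omega⟩
  obtain ⟨y, rfl⟩ : ∃ y, v = c + 2 * y := ⟨(v - c) / 2, by omega⟩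
  have cop : c.Coprime (c + 2 * y) := by
    apply coprime_of
    intro p hp h1 h2
    have e1 : p ∣ 5 * (2 * e) ^ 2 := by
      have : p ∣ (c + 2 * y) ^ 2 := dvd_pow h2 two_ne_zero
      have h3 : p ∣ c ^ 2 := dvd_pow h1 two_ne_zero
      apply (Nat.dvd_add_right h3).1
      have : c ^ 2 + 5 * (2 * e) ^ 2 = (c + 2 * y) ^ 2 := by rw [hv, hc]; ring
      rw [this]; assumption
    have hpd : p ∣ 2 * e → False := by
      intro h
      have : p ∣ w ^ 2 := by
        apply (Nat.dvd_add_left (a := p) (b := w ^ 2) (c := 10 * (2 * e) ^ 2)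
          (Dvd.dvd.mul_left (dvd_pow h two_ne_zero) _)).1
        rw [← hc]; exact dvd_pow h1 two_ne_zero
      exact not_dvd_both hw hp (hp.dvd_of_dvd_pow this) h
    rcases (Nat.Prime.dvd_mul hp).1 e1 with h | h
    · have h5 : p = 5 := (Nat.prime_dvd_prime_iff_eq hp Nat.prime_five).1 h
      subst h5
      have : 5 ∣ w ^ 2 := by
        have := dvd_pow h1 two_ne_zero (n := 2)
        rw [hc] at this
        omega
      have hw5 := hp.dvd_of_dvd_pow this
      obtain ⟨c', rfl⟩ := h1
      obtain ⟨w', rfl⟩ := hw5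
      have : 5 ∣ (2 * e) ^ 2 := by
        have h2 : 2 * (2 * e) ^ 2 + 5 * w' ^ 2= 5 * c' ^ 2 := by nlinarith
        omega
      exact hpd (hp.dvd_of_dvd_pow this)
    · exact hpd (hp.dvd_of_dvd_pow h)
  have cop2 : y.Coprime (c + y) := by
    apply coprime_of
    intro p hp h1 h2
    have : p ∣ c := (Nat.dvd_add_left h1).1 h2
    exact not_dvd_both cop hp this (dvd_add this (Dvd.dvd.mul_left h1 _))
  have hprod : y * (c + y) = 5 * e ^ 2 := by nlinarith
  obtain ⟨f, g, rfl, hfg⟩ := split_five cop2 hprod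
  have hvv : c + 2 * y = 5 * f ^ 2 + g ^ 2 := by omega
  have hcz : (c:ℤ) ^ 2 = (5 * f ^ 2 - g ^ 2) ^ 2 := by
    rcases hfg with ⟨h1, h2⟩ | ⟨h1, h2⟩
    · have : (c:ℤ) = g ^ 2 - 5 * f ^ 2 := by zify at h1 h2; linarith
      rw [this]; ring
    · have : (c:ℤ) = 5 * f ^ 2 - g ^ 2 := by zify at h1 h2; linarith
      rw [this]
  refine ⟨f, g, rfl, hvv, cop, ?_, ?_, ?_⟩
  · apply coprime_of
    intro p hp h1 h2
    have a1 : p ∣ 5 * f ^ 2 := Dvd.dvd.mul_left (dvd_pow h1 two_ne_zero) _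
    have a2 : p ∣ g ^ 2 := dvd_pow h2 two_ne_zero
    rcases hfg with ⟨h3, h4⟩ | ⟨h3, h4⟩
    · exact not_dvd_both cop2 hp (h3 ▸ a1) (h4 ▸ a2)
    · exact not_dvd_both cop2 hp (h3 ▸ a2) (h4 ▸ a1)
  · rw [hvv] at p4
    rcases Nat.mod_two_eq_zero_or_one f with h | h <;>
    rcases Nat.mod_two_eq_zero_or_one g with h' | h' <;>
    simp [Nat.pow_mod, Nat.add_mod, Nat.mul_mod, h, h'] at p4 ⊢
  · zify at hc hv hvv
    rw [hvv] at hv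
    rw [hcz] at hc
    linear_combination 3 * hc - 2 * hv

set_option maxHeartbeats 1000000 in
lemma step2 {d w c v f g : ℕ} (hd : 0 < d) (hw : w.Coprime d)
    (hc : c ^ 2 = w ^ 2 + 10 * d ^ 2) (hv : v ^ 2 = w ^ 2 + 15 * d ^ 2)
    (hdf : d = 2 * (f * g)) (hvf : v = 5 * f ^ 2 + g ^ 2) (cop : c.Coprime v)
    (hfg : f.Coprime g)
    (hpar : (f + g) % 2 = 1) (hz : 25 * ((f:ℤ) ^ 2 - g ^ 2) ^ 2 = w ^ 2 + 24 * g ^ 4) :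
    ∃ α β : ℕ, g = α * β ∧ α.Coprime β ∧ β % 2 = 1 ∧
      25 * ((f:ℤ) ^ 2 - g ^ 2) ^ 2 = (2 * α ^ 4 + 3 * β ^ 4) ^ 2 := by
  obtain ⟨p1, p2, p3⟩ := parity_aux hw hc
  obtain ⟨Z, hZ⟩ : ∃ Z : ℕ, Z = (5 * ((f:ℤ) ^ 2 - g ^ 2)).natAbs := ⟨_, rfl⟩
  have h5Z : 5 ∣ Z := by
    rw [hZ, Int.natAbs_mul]; exact Dvd.intro _ rfl
  have hZ2z : (Z:ℤ) ^ 2 = 25 * ((f:ℤ) ^ 2 - g ^ 2) ^ 2 := by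
    rw [hZ, Int.natCast_natAbs, sq_abs]; ring
  have hZ2 : Z ^ 2 = w ^ 2 + 24 * g ^ 4 := by
    zify; rw [hZ2z, hz]
  have hg : 0 < g := by
    rcases Nat.eq_zero_or_pos g with h | h
    · subst h; simp at hdf; omega
    · exact h
  have hwZ : w < Z := by
    apply lt_of_pow_lt_pow_left₀ 2 (Nat.zero_le _)
    have : 0 < g ^ 4 := by positivity
    omega
  have hZo : Z % 2 = 1 := by
    have : Z ^ 2 % 2 = (w ^ 2 + 24 * g ^ 4) % 2 := by rw [hZ2]
    rcases Nat.mod_two_eq_zero_or_one Z with h | h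
    · simp [Nat.pow_mod, Nat.add_mod, Nat.mul_mod, h, p1] at this
    · exact h
  obtain ⟨A, hA⟩ : ∃ A, Z = w + 2 * A := ⟨(Z - w) / 2, by omega⟩
  have hprod : A * (A + w) = 6 * g ^ 4 := by
    rw [hA] at hZ2; nlinarith
  have hwZc : ∀ p : ℕ, p.Prime → p ∣ w → p ∣ Z → False := by
    intro p hp h1 h2
    have hd' : p ∣ 24 * g ^ 4 := by
      apply (Nat.dvd_add_right (dvd_pow h1 two_ne_zero)).1
      rw [← hZ2]; exact dvd_pow h2 two_ne_zero
    have hpg : p ∣ g → False := by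
      intro h
      exact not_dvd_both hw hp h1 (hdf ▸ (h.mul_left _).mul_left _)
    rcases (Nat.Prime.dvd_mul hp).1 hd' with h | h
    · have h24 : p ∣ 2 ^ 3 * 3 := by simpa using h
      rcases (Nat.Prime.dvd_mul hp).1 h24 with h | h
      · have := (Nat.prime_dvd_prime_iff_eq hp Nat.prime_two).1 (hp.dvd_of_dvd_pow h)
        subst this; omega
      · have := (Nat.prime_dvd_prime_iff_eq hp Nat.prime_three).1 h
        subst this
        obtain ⟨w', rfl⟩ := h1
        have hv3 : 3 ∣ v ^ 2 := by
          rw [hv]; exact ⟨3 * w' ^ 2 + 5 * d ^ 2, by ring⟩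
        obtain ⟨v', rfl⟩ := hp.dvd_of_dvd_pow hv3
        have hc3 : c ^ 2 = 3 * (w' ^ 2 + 2 * v' ^ 2) := by nlinarith
        exact not_dvd_both cop hp (hp.dvd_of_dvd_pow ⟨_, hc3⟩) ⟨_, rfl⟩
    · exact hpg (hp.dvd_of_dvd_pow h)
  have cop3 : A.Coprime (A + w) := by
    apply coprime_of
    intro p hp h1 h2
    have h3 : p ∣ w := (Nat.dvd_add_right h1).1 h2
    exact hwZc p hp h3 (hA ▸ dvd_add h3 (h1.mul_left _))
  have hg5 : ¬ 5 ∣ g := by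
    intro h
    have h1 : 5 ∣ w ^ 2 := by
      obtain ⟨z, rfl⟩ := h5Z
      obtain ⟨g', rfl⟩ := h
      have : 5 ∣ w ^ 2 + 24 * (5 * g') ^ 4 := by rw [← hZ2]; exact ⟨5 * z ^ 2, by ring⟩
      exact (Nat.dvd_add_left ⟨24 * 125 * g' ^ 4, by ring⟩).1 this
    exact hwZc 5 Nat.prime_five (Nat.prime_five.dvd_of_dvd_pow h1) h5Z
  obtain ⟨x, y, rfl, h | h⟩ := split_six cop3 hprod
  · exfalso
    have hx : ¬ x % 5 = 0 := fun h => hg5 (Dvd.dvd.mul_right (Nat.dvd_of_mod_eq_zero h) _)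
    have hy : ¬ y % 5 = 0 := fun h => hg5 (Dvd.dvd.mul_left (Nat.dvd_of_mod_eq_zero h) _)
    have hzz : (x ^ 4 + 6 * y ^ 4) % 5 = 0 := by omega
    have hx4 : x ^ 4 % 5 = 1 := by
      have : x % 5 = 1 ∨ x % 5 = 2 ∨ x % 5 = 3 ∨ x % 5 = 4 := by omega
      rcases this with h | h | h | h <;> simp [Nat.pow_mod, h]
    have hy4 : y ^ 4 % 5 = 1 := by
      have : y % 5 = 1 ∨ y % 5 = 2 ∨ y % 5 = 3 ∨ y % 5 = 4 := by omega
      rcases this with h | h | h | h <;> simp [Nat.pow_mod, h]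
    omega
  · have hZe : Z = 2 * x ^ 4 + 3 * y ^ 4 := by omega
    refine ⟨x, y, rfl, ?_, ?_, ?_⟩
    · apply coprime_of
      intro p hp h1 h2
      have : p ^ 4 ∣ A * (A + w) := by
        rw [hprod]
        exact Dvd.dvd.mul_left (pow_dvd_pow_of_dvd (h1.mul_right _) 4) _
      have hpZ : p ∣ Z := by
        rw [hZe]
        exact dvd_add (Dvd.dvd.mul_left (dvd_pow h1 four_ne_zero) _)
          (Dvd.dvd.mul_left (dvd_pow h2 four_ne_zero) _)
      have hpA : p ∣ A * (A + w) := (dvd_pow_self p four_ne_zero).trans this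
      have e : Z = A + (A + w) := by omega
      rw [e] at hpZ
      rcases (Nat.Prime.dvd_mul hp).1 hpA with h | h
      · exact not_dvd_both cop3 hp h ((Nat.dvd_add_right h).1 hpZ)
      · exact not_dvd_both cop3 hp ((Nat.dvd_add_left h).1 hpZ) h
    · rcases Nat.mod_two_eq_zero_or_one y with h | h
      · have : y ^ 4 % 2 = 0 := by simp [Nat.pow_mod, h]
        clear hz hZ2z hZ hZ2 hprod hc hv hvf hdf
        omega
      · exact h
    · rw [← hZ2z, hZe]; push_cast; ring

lemma odd_sq8 {b : ℕ} (h : b % 2 = 1) : b ^ 2 % 8 = 1 := by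
  have : b % 8 = 1 ∨ b % 8 = 3 ∨ b % 8 = 5 ∨ b % 8 = 7 := by omega
  rcases this with h | h | h | h <;> simp [Nat.pow_mod, h]

lemma sq8 (b : ℕ) : b ^ 2 % 8 = 0 ∨ b ^ 2 % 8 = 1 ∨ b ^ 2 % 8 = 4 := by
  have : b % 8 = 0 ∨ b % 8 = 1 ∨ b % 8 = 2 ∨ b % 8 = 3 ∨ b % 8 = 4 ∨ b % 8 = 5 ∨ b % 8 = 6
    ∨ b % 8 = 7 := by omega
  rcases this with h | h | h | h | h | h | h | h <;> simp [Nat.pow_mod, h]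

lemma even_sq4 {b : ℕ} (h : b % 2 = 0) : b ^ 2 % 4 = 0 := by
  have : b % 4 = 0 ∨ b % 4 = 2 := by omega
  rcases this with h | h <;> simp [Nat.pow_mod, h]

lemma step3 {f g α β : ℕ} (hf : 0 < f) (hg : g = α * β) (hαβ : α.Coprime β) (hβ : β % 2 = 1)
    (hpar : (f + g) % 2 = 1)
    (hz : 25 * ((f:ℤ) ^ 2 - g ^ 2) ^ 2 = (2 * α ^ 4 + 3 * β ^ 4) ^ 2) :
    ∃ h k : ℕ, 0 < k ∧ k ≤ f ∧ h.Coprime k ∧ β ^ 2 = h ^ 2 + 10 * k ^ 2 ∧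
      α ^ 2 = h ^ 2 + 15 * k ^ 2 := by
  have hβ8 := odd_sq8 hβ
  have hz' : (5 * ((f:ℤ) ^ 2 - g ^ 2)) ^ 2 = (2 * α ^ 4 + 3 * β ^ 4) ^ 2 := by
    rw [← hz]; ring
  subst hg
  have hβ4 : β ^ 4 % 8 = 1 := by
    have : β ^ 4 = (β ^ 2) ^ 2 := by ring
    rw [this, Nat.pow_mod, hβ8]
  rcases sq_eq_sq_iff_eq_or_eq_neg.1 hz' with h | h
  · exfalso
    have hn : 5 * f ^ 2 = 5 * (α ^ 2 * β ^ 2) + 2 * α ^ 4 + 3 * β ^ 4 := by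
      zify; push_cast at h; linear_combination h
    rcases Nat.mod_two_eq_zero_or_one α with ha | ha
    · have hfo : f % 2 = 1 := by
        have : (α * β) % 2 = 0 := by simp [Nat.mul_mod, ha]
        omega
      have hf8 := odd_sq8 hfo
      have h4 := even_sq4 ha
      have : α ^ 4 % 4 = 0 := by
        have : α ^ 4 = (α ^ 2) ^ 2 := by ring
        rw [this, Nat.pow_mod, h4]
      have h5 : (α ^ 2 * β ^ 2) % 4 = 0 := by rw [Nat.mul_mod, h4]; simp
      omega
    · have hfe : f % 2 = 0 := by
        have : (α * β) % 2 = 1 := by simp [Nat.mul_mod, ha, hβ]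
        omega
      have hf4 := even_sq4 hfe
      have ha8 := odd_sq8 ha
      have h4 : α ^ 4 % 8 = 1 := by
        have : α ^ 4 = (α ^ 2) ^ 2 := by ring
        rw [this, Nat.pow_mod, ha8]
      have h5 : (α ^ 2 * β ^ 2) % 8 = 1 := by rw [Nat.mul_mod, ha8, hβ8]
      omega
  · have hn : (3 * (β:ℤ) ^ 2 - 2 * α ^ 2) * (α ^ 2 - β ^ 2) = 5 * f ^ 2 := by
      push_cast at h; linear_combination -h
    have hfp : (0:ℤ) < 5 * f ^ 2 := by positivity
    have hpos : 2 * α ^ 2 < 3 * β ^ 2 ∧ β ^ 2 < α ^ 2 := by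
      zify
      rcases pos_and_pos_or_neg_and_neg_of_mul_pos (hn ▸ hfp) with ⟨h1, h2⟩ | ⟨h1, h2⟩
      · constructor <;> linarith
      · exfalso; nlinarith [sq_nonneg (β:ℤ)]
    obtain ⟨S, hS⟩ : ∃ S, 3 * β ^ 2 = 2 * α ^ 2 + S := ⟨3 * β ^ 2 - 2 * α ^ 2, by omega⟩
    obtain ⟨T, hT⟩ : ∃ T, α ^ 2 = β ^ 2 + T := ⟨α ^ 2 - β ^ 2, by omega⟩
    have hST : S * T = 5 * f ^ 2 := by
      zify at hS hT ⊢
      rw [← hn, hS, hT]; ring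
    have cop : S.Coprime T := by
      apply coprime_of
      intro p hp h1 h2
      have hb : p ∣ β ^ 2 := by
        have : β ^ 2 = S + 2 * T := by omega
        rw [this]; exact dvd_add h1 (h2.mul_left _)
      have ha : p ∣ α ^ 2 := by rw [hT]; exact dvd_add hb h2
      exact not_dvd_both hαβ hp (hp.dvd_of_dvd_pow ha) (hp.dvd_of_dvd_pow hb)
    have hS8 : S % 8 = 3 ∨ S % 8 = 1 := by
      rcases Nat.mod_two_eq_zero_or_one α with ha | ha
      · have := even_sq4 ha; omega
      · have := odd_sq8 ha; omega
    obtain ⟨k, g', hk, ⟨h1, h2⟩ | ⟨h1, h2⟩⟩ := split_five cop hST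
    · exfalso
      have := sq8 k
      omega
    · have hk0 : 0 < k := by
        rcases Nat.eq_zero_or_pos k with h | h
        · subst h; simp at hk; omega
        · exact h
      have hg0 : 0 < g' := by
        rcases Nat.eq_zero_or_pos g' with h | h
        · subst h; simp at hk; omega
        · exact h
      refine ⟨g', k, hk0, ?_, ?_, by omega, by omega⟩
      · rw [hk]; exact Nat.le_mul_of_pos_right _ hg0
      · apply coprime_of
        intro p hp a1 a2
        exact not_dvd_both cop hp (h1 ▸ dvd_pow a1 two_ne_zero)
          (h2 ▸ Dvd.dvd.mul_left (dvd_pow a2 two_ne_zero) _)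

lemma descent_s5 : ∀ d w c v : ℕ, 0 < d → w.Coprime d →
    c ^ 2 = w ^ 2 + 10 * d ^ 2 → v ^ 2 = w ^ 2 + 15 * d ^ 2 → False := by
  intro d
  induction d using Nat.strong_induction_on with
  | _ d ih =>
  intro w c v hd hw hc hv
  obtain ⟨f, g, h1, h2, h3, h4, h5, h6⟩ := step1 hd hw hc hv
  obtain ⟨α, β, a1, a2, a3, a4⟩ := step2 hd hw hc hv h1 h2 h3 h4 h5 h6
  have hf : 0 < f := by
    rcases Nat.eq_zero_or_pos f with h | h
    · subst h; simp at h1; omega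
    · exact h
  have hg : 0 < g := by
    rcases Nat.eq_zero_or_pos g with h | h
    · subst h; simp at h1; omega
    · exact h
  obtain ⟨h, k, b1, b2, b3, b4, b5⟩ := step3 hf a1 a2 a3 h5 a4
  refine ih k ?_ h β α b1 b3 b4 b5
  have : f ≤ f * g := Nat.le_mul_of_pos_right _ hg
  omega

lemma sq3 (b : ℕ) : (b % 3 = 0 ∧ b ^ 2 % 3 = 0) ∨ (b % 3 ≠ 0 ∧ b ^ 2 % 3 = 1) := by
  have : b % 3 = 0 ∨ b % 3 = 1 ∨ b % 3 = 2 := by omega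
  rcases this with h | h | h <;> simp [Nat.pow_mod, h]

lemma sq5 (b : ℕ) : b ^ 2 % 5 = 0 ∨ b ^ 2 % 5 = 1 ∨ b ^ 2 % 5 = 4 := by
  have : b % 5 = 0 ∨ b % 5 = 1 ∨ b % 5 = 2 ∨ b % 5 = 3 ∨ b % 5 = 4 := by omega
  rcases this with h | h | h | h | h <;> simp [Nat.pow_mod, h]

/-- Main arithmetic fact: `s` triangular, `s (s-1) = 5 r^2` forces `m < 2`. -/
lemma main_nat {m s r : ℕ} (hm : 2 ≤ m) (hs : m * (m + 1) = 2 * (s + 1))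
    (h : (s + 1) * s = 5 * r ^ 2) : False := by
  have cop : (s + 1).Coprime s := by simp
  obtain ⟨a, b, rfl, ⟨h1, h2⟩ | ⟨h1, h2⟩⟩ := split_five cop h
  · -- `s + 1 = 5 a^2`, `s = b^2`
    have hm3 : (m * (m + 1)) % 3 = 0 ∨ (m * (m + 1)) % 3 = 2 := by
      have : m % 3 = 0 ∨ m % 3 = 1 ∨ m % 3 = 2 := by omega
      rcases this with h | h | h <;> simp [Nat.mul_mod, Nat.add_mod, h]
    have := sq3 a
    have := sq3 b
    omega
  · -- `s + 1 = b^2`, `s = 5 a^2`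
    have cop2 : m.Coprime (m + 1) := by simp
    rw [h1] at hs
    rcases split_prime Nat.prime_two cop2 hs with ⟨m', e1, e2, e3⟩ | ⟨m', e1, e2, e3⟩
    · obtain ⟨v, u, rfl, hu, rfl⟩ := split_pow two_ne_zero e3 e2
      -- `m = 2 v^2`, `m + 1 = u^2`
      have hvpos : 0 < v ^ 2 := by omega
      obtain ⟨V, hV⟩ : ∃ V, 2 * v ^ 2 = V + 1 := ⟨2 * v ^ 2 - 1, by omega⟩
      have hu' : u ^ 2 = 2 * v ^ 2 + 1 := by omega
      have hVp : V * (v ^ 2 + 1) = 5 * a ^ 2 := by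
        have e : v ^ 2 * u ^ 2 = 5 * a ^ 2 + 1 := by rw [← mul_pow]; omega
        rw [hu'] at e
        zify at *
        have : (V:ℤ) = 2 * v ^ 2 - 1 := by linarith
        rw [this]; linear_combination e
      have c3 : V.Coprime (v ^ 2 + 1) := by
        apply coprime_of
        intro p hp p1 p2
        have : p ∣ 3 := by
          have : V + 3 = 2 * (v ^ 2 + 1) := by omega
          apply (Nat.dvd_add_right p1).1
          rw [this]; exact p2.mul_left _
        have := (Nat.prime_dvd_prime_iff_eq hp Nat.prime_three).1 this
        subst this
        have := sq3 v
        omega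
      obtain ⟨x, y, _, ⟨q1, q2⟩ | ⟨q1, q2⟩⟩ := split_five c3 hVp
      · have := sq5 v; omega
      · have := sq8 u; have := sq8 y; omega
    · obtain ⟨u, v, hu, rfl, rfl⟩ := split_pow two_ne_zero e3 e2
      -- `m = u^2`, `m + 1 = 2 v^2`
      obtain ⟨W, hW⟩ : ∃ W, v ^ 2 = W + 1 := ⟨v ^ 2 - 1, by omega⟩
      have hu' : u ^ 2 = 2 * W + 1 := by omega
      have hWp : W * (2 * W + 3) = 5 * a ^ 2 := by
        have e : u ^ 2 * v ^ 2 = 5 * a ^ 2 + 1 := by rw [← mul_pow]; omega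
        rw [hu', hW] at e
        nlinarith
      by_cases h3 : W % 3 = 0
      · obtain ⟨z, rfl⟩ : ∃ z, W = 3 * z := ⟨W / 3, by omega⟩
        have ha3 : a % 3 = 0 := by
          have : 3 ∣ 5 * a ^ 2 := by rw [← hWp]; exact ⟨z * (2 * (3 * z) + 3), by ring⟩
          have := sq3 a
          omega
        obtain ⟨b, rfl⟩ : ∃ b, a = 3 * b := ⟨a / 3, by omega⟩
        have hz : z * (2 * z + 1) = 5 * b ^ 2 := by nlinarith
        have c4 : z.Coprime (2 * z + 1) := by
          apply coprime_of
          intro p hp p1 p2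
          exact hp.one_lt.ne' (Nat.dvd_one.1 ((Nat.dvd_add_right (p1.mul_left 2)).1 p2))
        obtain ⟨x, y, _, ⟨q1, q2⟩ | ⟨q1, q2⟩⟩ := split_five c4 hz
        · refine descent_s5 x 1 y v ?_ (by simp) (by omega) (by omega)
          rcases Nat.eq_zero_or_pos x with h | h
          · subst h; simp at q1; omega
          · exact h
        · have := sq5 u; omega
      · have c4 : W.Coprime (2 * W + 3) := by
          apply coprime_of
          intro p hp p1 p2
          have : p ∣ 3 := (Nat.dvd_add_right (p1.mul_left 2)).1 p2
          have := (Nat.prime_dvd_prime_iff_eq hp Nat.prime_three).1 this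
          subst this
          omega
        obtain ⟨x, y, _, ⟨q1, q2⟩ | ⟨q1, q2⟩⟩ := split_five c4 hWp
        · have := sq8 u; have := sq8 y; omega
        · have := sq5 u; omega

lemma core {X P : ℤ} (ho : Odd X) (hX : 5 ≤ X)
    (h : (X ^ 2 - 1) * (X ^ 2 - 9) = 20 * P ^ 2) : False := by
  obtain ⟨m, rfl⟩ := ho
  obtain ⟨n, rfl⟩ := Int.eq_ofNat_of_zero_le (show 0 ≤ m by omega)
  have hn : 2 ≤ n := by omega
  obtain ⟨s, hs⟩ : ∃ s, n * (n + 1) = 2 * (s + 1) := by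
    obtain ⟨t, ht⟩ := Nat.even_mul_succ_self n
    refine ⟨t - 1, ?_⟩
    have : 0 < n * (n + 1) := by positivity
    omega
  have hsz : (n:ℤ) * (n + 1) = 2 * (s + 1) := by exact_mod_cast hs
  have h16 : 16 * (((s:ℤ) + 1) * s) = 5 * P ^ 2 := by
    have e1 : (2 * (n:ℤ) + 1) ^ 2 = 8 * s + 9 := by linear_combination 4 * hsz
    rw [e1] at h
    linarith
  have h4 : (4:ℤ) ∣ P := by
    have : IsCoprime (16:ℤ) 5 := by norm_num
    have h1 : (4:ℤ) ^ 2 ∣ P ^ 2 := by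
      apply this.dvd_of_dvd_mul_left
      rw [← h16]; exact ⟨((s:ℤ) + 1) * s, by ring⟩
    exact (Int.pow_dvd_pow_iff two_ne_zero).1 h1
  obtain ⟨r, rfl⟩ := h4
  refine main_nat (r := r.natAbs) hn hs ?_
  zify
  rw [sq_abs]
  linarith

theorem no_odd_ge_five_sol :
    (¬ ∃ X P : ℤ, Odd X ∧ 5 ≤ X ∧ (X ^ 2 - 5) ^ 2 = 4 * (5 * P ^ 2 + 4)) ∧
    (¬ ∃ X Q : ℤ, Odd X ∧ 5 ≤ X ∧ (X ^ 2 - 1) * (X ^ 2 - 9) = 5 * Q ^ 2 ∧ Even Q) := by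
  constructor
  · rintro ⟨X, P, ho, hX, h⟩
    exact core (P := P) ho hX (by linear_combination h)
  · rintro ⟨X, Q, ho, hX, h, ⟨P, rfl⟩⟩
    exact core (P := P) ho hX (by linear_combination h)
end

section
/- Every solution of x^2 = 2u + v with x in the ring of integers of Q(√5) and u, v units is, up to scaling by squares of units and conjugation, one of: 1^2 = 2·1 - 1, 1^2 = 2(-ε) + ε^3, ε^2 = 2·1 - ε', (√5)^2 = 2ε^2 + (ε')^3, (8 + 15ε)^2 = 2ε^13 + ε'. -/
open Polynomial

/-- The ring of integers `ℤ[ε]` of `ℚ(√5)`, with `ε = (1+√5)/2` a root of `X² - X - 1`. -/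
noncomputable abbrev GoldRing : Type := AdjoinRoot (X ^ 2 - X - 1 : ℤ[X])

/-- The fundamental unit `ε = (1+√5)/2`. -/
noncomputable def ε : GoldRing := AdjoinRoot.root _

/-- The conjugate `ε' = (1-√5)/2 = 1 - ε`. -/
noncomputable def ε' : GoldRing := 1 - ε

/-- `√5 = 2ε - 1` in `ℤ[ε]`. -/
noncomputable def sqrt5 : GoldRing := 2 * ε - 1


namespace GoldAux

/-- Fibonacci-type sequence with initial values `a`, `b`. -/
def lu (a b : ℤ) : ℕ → ℤ
  | 0 => a
  | 1 => b
  | n + 2 => lu a b n + lu a b (n + 1)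

/-- Fibonacci-type sequence of pairs modulo `p`. -/
def st (p : ℕ) : ℕ → ℕ → ℕ → ℕ × ℕ
  | 0, a, b => (a, b)
  | n + 1, a, b => st p n b ((a + b) % p)

theorem lu_succ_eq (a b : ℤ) (n : ℕ) : lu a b (n + 1) = lu b (a + b) n := by
  induction n using Nat.twoStepInduction with
  | zero => rfl
  | one => rfl
  | more n h1 h2 =>
    rw [show lu a b (n + 2 + 1) = lu a b (n + 1) + lu a b (n + 2) from rfl, h1, h2]; rfl

theorem lu_shift (a b : ℤ) (m n : ℕ) :
    lu a b (m + n) = lu (lu a b m) (lu a b (m + 1)) n := by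
  induction n using Nat.twoStepInduction with
  | zero => rfl
  | one => rfl
  | more n h1 h2 =>
    rw [show lu a b (m + (n + 2)) = lu a b (m + n) + lu a b (m + (n + 1)) from rfl, h1, h2]; rfl

theorem lu_congr (p : ℤ) (a b c d : ℤ) (h1 : a ≡ c [ZMOD p]) (h2 : b ≡ d [ZMOD p]) (n : ℕ) :
    lu a b n ≡ lu c d n [ZMOD p] := by
  induction n using Nat.twoStepInduction with
  | zero => exact h1
  | one => exact h2
  | more n h1 h2 => exact h1.add h2

theorem st_spec (p n a b : ℕ) : ((st p n a b).1 : ℤ) ≡ lu a b n [ZMOD p] ∧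
    ((st p n a b).2 : ℤ) ≡ lu a b (n + 1) [ZMOD p] := by
  induction n generalizing a b with
  | zero => exact ⟨rfl, rfl⟩
  | succ n ih =>
    have h : (((a + b) % p : ℕ) : ℤ) ≡ a + b [ZMOD p] := by
      push_cast; exact Int.mod_modEq _ _
    have := ih b ((a + b) % p)
    refine ⟨this.1.trans ?_, this.2.trans ?_⟩
    · rw [lu_succ_eq]; exact lu_congr _ _ _ _ _ rfl h n
    · rw [lu_succ_eq a b (n + 1)]; exact lu_congr _ _ _ _ _ rfl h (n + 1)

/-- Boolean test: `P` is a period mod `p` and `2 * lu i + s` is a nonresidue for `i ∈ kill`. -/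
def chk (p P a b s : ℕ) (kill : List ℕ) : Bool :=
  decide (st p P a b = (a, b)) &&
  kill.all (fun i => (fun c => (List.range p).all (fun y => !(Nat.beq (y * y % p) c)))
    ((2 * (st p i a b).1 + s) % p))

theorem sieve (p P A B S : ℕ) (kill : List ℕ) (hc : chk p P A B S kill = true)
    (a b s : ℤ) (hp : 0 < p) (ha : a ≡ A [ZMOD p]) (hb : b ≡ B [ZMOD p]) (hs : s ≡ S [ZMOD p])
    (n : ℕ) (y : ℤ) (h : y ^ 2 = 2 * lu a b n + s) : n % P ∉ kill := by
  intro hk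
  simp only [chk, Bool.and_eq_true, decide_eq_true_eq, List.all_eq_true, List.mem_range] at hc
  obtain ⟨hP, hc⟩ := hc
  have hper : ∀ t m : ℕ, lu A B (P * t + m) ≡ lu A B m [ZMOD p] := by
    intro t
    induction t with
    | zero => intro m; simp
    | succ t ih =>
      intro m
      rw [show P * (t + 1) + m = P + (P * t + m) by ring, lu_shift]
      refine (lu_congr _ _ _ A B ?_ ?_ _).trans (ih m)
      · have := (st_spec p P A B).1; rw [hP] at this; exact this.symm
      · have := (st_spec p P A B).2; rw [hP] at this; exact this.symm
  have h1 : lu a b n ≡ lu A B (n % P) [ZMOD p] := by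
    refine (lu_congr _ _ _ _ _ ha hb n).trans ?_
    have := hper (n / P) (n % P)
    rwa [Nat.div_add_mod] at this
  have h2 : y ^ 2 ≡ 2 * (st p (n % P) A B).1 + S [ZMOD p] := by
    rw [h]
    exact ((h1.trans (st_spec p (n % P) A B).1.symm).mul_left 2).add hs
  have hp' : (p : ℤ) ≠ 0 := by positivity
  have h3 := hc _ hk (y % p).toNat (by
    have := Int.emod_lt_of_pos y (show (0 : ℤ) < p by positivity)
    have := Int.emod_nonneg y hp'
    omega)
  have h4 : (y % p).toNat * (y % p).toNat % p = (2 * (st p (n % P) A B).1 + S) % p := by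
    zify
    rw [Int.toNat_of_nonneg (Int.emod_nonneg y hp')]
    have : (y % p) * (y % p) ≡ y ^ 2 [ZMOD p] := by
      rw [pow_two]; exact (Int.mod_modEq _ _).mul (Int.mod_modEq _ _)
    exact this.trans h2
  rw [h4] at h3
  simp at h3

theorem lu_fib (a b : ℤ) (n : ℕ) :
    lu a b n = a * (Nat.fib (n + 1) - Nat.fib n) + b * Nat.fib n := by
  induction n using Nat.twoStepInduction with
  | zero => simp [lu]
  | one => simp [lu]
  | more n h1 h2 =>
    rw [show lu a b (n + 2) = lu a b n + lu a b (n + 1) from rfl, h1, h2,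
      Nat.fib_add_two (n := n + 1), Nat.fib_add_two (n := n)]
    push_cast; ring

theorem cassini (n : ℕ) : (Nat.fib n : ℤ) ^ 2 + Nat.fib n * Nat.fib (n + 1)
    - (Nat.fib (n + 1) : ℤ) ^ 2 = -(-1) ^ n := by
  induction n with
  | zero => simp
  | succ n ih =>
    rw [Nat.fib_add_two, pow_succ, ← sub_eq_zero]
    push_cast
    linear_combination (-1) * ih

theorem lu_double (a b : ℤ) (K : ℕ) (hK : Even K) :
    lu a b (2 * K) + a = lu 2 1 K * lu a b K := by
  have hc := cassini K
  rw [hK.neg_one_pow] at hc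
  rw [lu_fib, lu_fib, lu_fib, Nat.fib_two_mul_add_one, Nat.fib_two_mul]
  have : Nat.fib K ≤ 2 * Nat.fib (K + 1) := by
    have := Nat.fib_le_fib_succ (n := K); omega
  push_cast [this]
  linear_combination a * hc

theorem lu_dvd (a b : ℤ) (K : ℕ) (hK : Even K) (t : ℕ) :
    lu 2 1 K ∣ lu a b (t + 2 * K) + lu a b t := by
  rw [lu_shift, lu_double _ _ _ hK]; exact dvd_mul_right _ _

theorem lu_dvd_odd (a b : ℤ) (K : ℕ) (hK : Even K) (h : ℕ) :
    lu 2 1 K ∣ lu a b (2 * K * (2 * h + 1)) + a := by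
  induction h with
  | zero => simpa [lu] using lu_dvd a b K hK 0
  | succ h ih =>
    have h1 := lu_dvd a b K hK (2 * K * (2 * h + 1))
    have h2 := lu_dvd a b K hK (2 * K * (2 * h + 1) + 2 * K)
    rw [show 2 * K * (2 * (h + 1) + 1) = 2 * K * (2 * h + 1) + 2 * K + 2 * K by ring]
    obtain ⟨c1, hc1⟩ := ih
    obtain ⟨c2, hc2⟩ := h1
    obtain ⟨c3, hc3⟩ := h2
    exact ⟨c1 - c2 + c3, by linear_combination hc1 - hc2 + hc3⟩

theorem lu_mod (p P : ℕ) (hP : st p P 2 1 = (2, 1)) (n : ℕ) :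
    lu 2 1 n ≡ lu 2 1 (n % P) [ZMOD p] := by
  have hper : ∀ t m : ℕ, lu 2 1 (P * t + m) ≡ lu 2 1 m [ZMOD p] := by
    intro t
    induction t with
    | zero => intro m; simp
    | succ t ih =>
      intro m
      rw [show P * (t + 1) + m = P + (P * t + m) by ring, lu_shift]
      refine (lu_congr _ _ _ 2 1 ?_ ?_ _).trans (ih m)
      · have := (st_spec p P 2 1).1; rw [hP] at this; exact this.symm
      · have := (st_spec p P 2 1).2; rw [hP] at this; exact this.symm
  have := hper (n / P) (n % P)
  rwa [Nat.div_add_mod] at this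

theorem lu_pos (n : ℕ) : 0 < lu 2 1 n := by
  induction n using Nat.twoStepInduction with
  | zero => simp [lu]
  | one => simp [lu]
  | more n h1 h2 => exact add_pos h1 h2

/-- The Lucas numbers, as natural numbers. -/
def M (K : ℕ) : ℕ := (lu 2 1 K).toNat

theorem M_cast (K : ℕ) : (M K : ℤ) = lu 2 1 K := Int.toNat_of_nonneg (lu_pos K).le

theorem M_mod4 (K : ℕ) (h2 : K % 2 = 0) (h3 : K % 3 ≠ 0) : M K % 4 = 3 := by
  have h := lu_mod 4 6 (by decide) K
  rw [← M_cast] at h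
  have : K % 6 = 2 ∨ K % 6 = 4 := by omega
  rcases this with h6 | h6 <;> rw [h6] at h <;> simp only [lu, Int.ModEq] at h <;> omega

theorem jac_kill (a b s y : ℤ) (K h : ℕ) (hK : Even K)
    (e : y ^ 2 = 2 * lu a b (2 * K * (2 * h + 1)) + s)
    (hJ : jacobiSym (s - 2 * a) (M K) = -1) : False := by
  have h1 := lu_dvd_odd a b K hK h
  rw [← M_cast] at h1
  have h2 : (s - 2 * a) % (M K : ℤ) = (y ^ 2) % (M K : ℤ) := by
    apply Int.ModEq.eq
    rw [Int.modEq_iff_dvd, e]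
    obtain ⟨c, hc⟩ := h1
    exact ⟨2 * c, by linear_combination 2 * hc⟩
  rw [jacobiSym.mod_left' h2, jacobiSym.pow_left] at hJ
  have := sq_nonneg (jacobiSym y (M K))
  omega

theorem jac_neg (d m : ℕ) (hd : d % 4 = 3) (hm : m % 4 = 3) :
    jacobiSym (-d) m = jacobiSym m d := by
  rw [jacobiSym.neg _ (Nat.odd_iff.2 (by omega)), ZMod.χ₄_nat_three_mod_four hm,
    jacobiSym.quadratic_reciprocity_three_mod_four hd hm]; ring

theorem jac_M (d P K c : ℕ) (hP : st d P 2 1 = (2, 1)) (hc : K % P = c) :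
    jacobiSym (M K) d = jacobiSym (lu 2 1 c) d := by
  apply jacobiSym.mod_left'
  rw [M_cast, ← hc]; exact lu_mod d P hP K

theorem jac19 (K : ℕ) (h : K % 18 = 2 ∨ K % 18 = 16) : jacobiSym (M K) 19 = -1 := by
  rcases h with h | h <;> rw [jac_M 19 18 K _ (by decide) h] <;> norm_num [lu]

theorem pow8 (s : ℕ) : 8 ^ s % 9 = 1 ∨ 8 ^ s % 9 = 8 := by
  induction s with
  | zero => simp
  | succ s ih => rw [pow_succ]; omega

theorem pow4 (s : ℕ) : 4 ^ s % 5 = 1 ∨ 4 ^ s % 5 = 4 := by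
  induction s with
  | zero => simp
  | succ s ih => rw [pow_succ]; omega

theorem pow2_mod3 (s : ℕ) : 2 ^ s % 3 = 1 ∨ 2 ^ s % 3 = 2 := by
  induction s with
  | zero => simp
  | succ s ih => rw [pow_succ]; omega

/-- Splitting off the power of two. -/
theorem split (z j : ℕ) (hz : z ≠ 0) (hj : 2 ^ (j + 1) ∣ z) :
    ∃ r, j ≤ r ∧ ∀ q, q % 2 = 1 → q ∣ z → ∃ h, z = 2 * (2 ^ r * q) * (2 * h + 1) := by
  obtain ⟨e, o, ho, rfl⟩ := Nat.exists_eq_two_pow_mul_odd hz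
  have he : j + 1 ≤ e := by
    have h1 : 2 ^ (j + 1) ∣ 2 ^ e := by
      refine Nat.Coprime.dvd_of_dvd_mul_right ?_ hj
      exact Nat.Coprime.pow_left _ (Nat.coprime_two_left.2 ho)
    exact (Nat.pow_dvd_pow_iff_le_right (by norm_num)).1 h1
  obtain ⟨r, rfl⟩ : ∃ r, e = r + 1 := ⟨e - 1, by omega⟩
  refine ⟨r, by omega, fun q hq hqz => ?_⟩
  have h2 : q ∣ o := by
    refine Nat.Coprime.dvd_of_dvd_mul_left ?_ hqz
    exact Nat.Coprime.pow_right _ (Nat.coprime_two_right.2 (Nat.odd_iff.2 hq))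
  obtain ⟨c, rfl⟩ := h2
  obtain ⟨h, rfl⟩ := (Nat.odd_mul.1 ho).2
  exact ⟨h, by ring⟩

theorem kill_common (a b s y : ℤ) (d z K h : ℕ) (hd : d % 4 = 3) (hs : s - 2 * a = -(d : ℤ))
    (hK2 : K % 2 = 0) (hK3 : K % 3 ≠ 0) (hz : z = 2 * K * (2 * h + 1))
    (e : y ^ 2 = 2 * lu a b z + s) (hJ : jacobiSym (M K) d = -1) : False := by
  subst hz
  refine jac_kill a b s y K h (Nat.even_iff.2 hK2) e ?_
  rw [hs, jac_neg d (M K) hd (M_mod4 K hK2 hK3), hJ]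

theorem even_pow (r : ℕ) (hr : 1 ≤ r) : 2 ^ r % 2 = 0 := by
  obtain ⟨t, rfl⟩ : ∃ t, r = t + 1 := ⟨r - 1, by omega⟩
  rw [pow_succ]; omega

theorem four_pow (r : ℕ) (hr : 2 ≤ r) : 2 ^ r % 4 = 0 := by
  obtain ⟨t, rfl⟩ : ∃ t, r = t + 2 := ⟨r - 2, by omega⟩
  rw [pow_add]; omega

theorem pow2_mod9 (r : ℕ) : (r % 3 = 0 ∧ (2 ^ r % 9 = 1 ∨ 2 ^ r % 9 = 8)) ∨
    (r % 3 = 1 ∧ (2 ^ r % 9 = 2 ∨ 2 ^ r % 9 = 7)) ∨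
    (r % 3 = 2 ∧ (2 ^ r % 9 = 4 ∨ 2 ^ r % 9 = 5)) := by
  induction r with
  | zero => simp
  | succ s ih => rw [pow_succ]; omega

theorem key19 (a b s y : ℤ) (z : ℕ) (hz : z ≠ 0) (h4 : 840 ∣ z) (hs : s - 2 * a = -19)
    (e : y ^ 2 = 2 * lu a b z + s) : False := by
  obtain ⟨r, hr, H⟩ := split z 1 hz (by omega)
  have h2 := even_pow r hr
  have h3 := pow2_mod3 r
  rcases pow2_mod9 r with ⟨-, h⟩ | ⟨-, h⟩ | ⟨-, h⟩
  · obtain ⟨o, ho⟩ := H 7 (by norm_num) (by omega)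
    exact kill_common a b s y 19 z _ o (by norm_num) hs (by omega) (by omega) ho e
      (jac19 _ (by omega))
  · obtain ⟨o, ho⟩ := H 1 (by norm_num) (by omega)
    exact kill_common a b s y 19 z _ o (by norm_num) hs (by omega) (by omega) ho e
      (jac19 _ (by omega))
  · obtain ⟨o, ho⟩ := H 5 (by norm_num) (by omega)
    exact kill_common a b s y 19 z _ o (by norm_num) hs (by omega) (by omega) ho e
      (jac19 _ (by omega))

theorem key5 (a b s y : ℤ) (z : ℕ) (hz : z ≠ 0) (h4 : 4 ∣ z) (hs : s - 2 * a = 5)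
    (e : y ^ 2 = 2 * lu a b z + s) : False := by
  obtain ⟨r, hr, H⟩ := split z 1 hz (by omega)
  have h2 := even_pow r hr
  have h3 := pow2_mod3 r
  obtain ⟨o, ho⟩ := H 1 (by norm_num) (by omega)
  subst ho
  refine jac_kill a b s y _ o (Nat.even_iff.2 (by omega)) e ?_
  have hM := M_mod4 (2 ^ r * 1) (by omega) (by omega)
  rw [hs]
  have := jacobiSym.quadratic_reciprocity_one_mod_four (a := 5) (b := M (2 ^ r * 1))
    (by norm_num) (Nat.odd_iff.2 (by omega))
  push_cast at this
  rw [this]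
  have h4 : (2 ^ r * 1) % 4 = 0 ∨ (2 ^ r * 1) % 4 = 2 := by omega
  rcases h4 with h | h <;> rw [jac_M 5 4 _ _ (by decide) h] <;> norm_num [lu]

theorem pow2_mod5 (r : ℕ) : (2 ^ r % 5 = 1 ∨ 2 ^ r % 5 = 4) ∨ (2 ^ r % 5 = 2 ∨ 2 ^ r % 5 = 3) := by
  induction r with
  | zero => simp
  | succ s ih => rw [pow_succ]; omega

theorem jac11 (K : ℕ) (h : K % 10 = 4 ∨ K % 10 = 6) : jacobiSym (M K) 11 = -1 := by
  rcases h with h | h <;> rw [jac_M 11 10 K _ (by decide) h] <;> norm_num [lu]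

theorem key11 (a b s y : ℤ) (z : ℕ) (hz : z ≠ 0) (h4 : 168 ∣ z) (hs : s - 2 * a = -11)
    (e : y ^ 2 = 2 * lu a b z + s) : False := by
  obtain ⟨r, hr, H⟩ := split z 1 hz (by omega)
  have h2 := even_pow r hr
  have h3 := pow2_mod3 r
  rcases pow2_mod5 r with h | h
  · obtain ⟨o, ho⟩ := H 1 (by norm_num) (by omega)
    exact kill_common a b s y 11 z _ o (by norm_num) hs (by omega) (by omega) ho e
      (jac11 _ (by omega))
  · obtain ⟨o, ho⟩ := H 7 (by norm_num) (by omega)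
    exact kill_common a b s y 11 z _ o (by norm_num) hs (by omega) (by omega) ho e
      (jac11 _ (by omega))

theorem jac1691 (K : ℕ) (h : K % 18 = 2 ∨ K % 18 = 16) (h' : K % 44 = 0) :
    jacobiSym (M K) 1691 = -1 := by
  rw [show 1691 = 19 * 89 by norm_num, jacobiSym.mul_right, jac19 K h,
    jac_M 89 44 K _ (by decide) h']
  norm_num [lu]

theorem key1691 (a b s y : ℤ) (z : ℕ) (hz : z ≠ 0) (h4 : 9240 ∣ z) (hs : s - 2 * a = -1691)
    (e : y ^ 2 = 2 * lu a b z + s) : False := by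
  obtain ⟨r, hr, H⟩ := split z 2 hz (by omega)
  have h2 := four_pow r hr
  have h3 := pow2_mod3 r
  rcases pow2_mod9 r with ⟨-, h⟩ | ⟨-, h⟩ | ⟨-, h⟩
  · obtain ⟨o, ho⟩ := H 11 (by norm_num) (by omega)
    exact kill_common a b s y 1691 z _ o (by norm_num) hs (by omega) (by omega) ho e
      (jac1691 _ (by omega) (by omega))
  · obtain ⟨o, ho⟩ := H 55 (by norm_num) (by omega)
    exact kill_common a b s y 1691 z _ o (by norm_num) hs (by omega) (by omega) ho e
      (jac1691 _ (by omega) (by omega))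
  · obtain ⟨o, ho⟩ := H 77 (by norm_num) (by omega)
    exact kill_common a b s y 1691 z _ o (by norm_num) hs (by omega) (by omega) ho e
      (jac1691 _ (by omega) (by omega))

theorem notmem {m m' : ℕ} {l : List ℕ} (h : m ∉ l) (e : m' = m) : m' ∉ l := e ▸ h

set_option synthInstance.maxSize 2000 in
set_option synthInstance.maxHeartbeats 400000 in
/-- First sequence equation. -/
theorem solveA (j : ℕ) (y : ℤ) (e : y ^ 2 = 2 * lu (-1) 2 (6 * j) + 3) : j = 0 ∨ j = 1 := by
  by_contra! hj
  by_cases h2 : j % 2 = 0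
  · exact key5 (-1) 2 3 y (6 * j) (by omega) (by omega) (by norm_num) e
  have k1 := sieve 3 8 2 2 0 [2] (by decide +kernel) (-1) 2 3
    (by decide) (by decide) (by decide) (by decide) _ y e
  have k2 := sieve 13 28 12 2 3 [2, 14, 18, 26] (by decide +kernel) (-1) 2 3
    (by decide) (by decide) (by decide) (by decide) _ y e
  have k3 := sieve 29 14 28 2 3 [8, 10] (by decide +kernel) (-1) 2 3
    (by decide) (by decide) (by decide) (by decide) _ y e
  have k4 := sieve 41 40 40 2 3 [30] (by decide +kernel) (-1) 2 3
    (by decide) (by decide) (by decide) (by decide) _ y e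
  have k5 := sieve 61 60 60 2 3 [18, 42, 54] (by decide +kernel) (-1) 2 3
    (by decide) (by decide) (by decide) (by decide) _ y e
  have hfin : ∀ t < 70, (6 + 12 * t) % 8 ∉ [2] → (6 + 12 * t) % 28 ∉ [2, 14, 18, 26] →
      (6 + 12 * t) % 14 ∉ [8, 10] → (6 + 12 * t) % 40 ∉ [30] →
      (6 + 12 * t) % 60 ∉ [18, 42, 54] → t = 0 := by decide +kernel
  have h0 : j / 2 % 70 = 0 := hfin (j / 2 % 70) (by omega)
    (notmem k1 (by omega)) (notmem k2 (by omega)) (notmem k3 (by omega))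
    (notmem k4 (by omega)) (notmem k5 (by omega))
  obtain ⟨z, hz⟩ : ∃ z, 6 * j = 6 + z := ⟨6 * j - 6, by omega⟩
  rw [hz, lu_shift] at e
  exact key19 _ _ 3 y z (by omega) (by omega) (by norm_num [lu]) e

set_option synthInstance.maxSize 2000 in
set_option synthInstance.maxHeartbeats 400000 in
/-- Second sequence equation. -/
theorem solveB (j : ℕ) (y : ℤ) (e : y ^ 2 = 2 * lu 2 1 (6 * j + 2) - 5) : j = 0 ∨ j = 2 := by
  by_contra! hj
  rw [sub_eq_add_neg] at e
  have k13 := sieve 13 28 2 1 8 [6, 8, 10, 12, 16, 18, 20, 22] (by decide +kernel) 2 1 (-5)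
    (by decide) (by decide) (by decide) (by decide) _ y e
  have k83 := sieve 83 168 2 1 78 [86, 98, 140] (by decide +kernel) 2 1 (-5)
    (by decide) (by decide) (by decide) (by decide) _ y e
  have k71 := sieve 71 70 2 1 66 [16, 46, 54] (by decide +kernel) 2 1 (-5)
    (by decide) (by decide) (by decide) (by decide) _ y e
  have hmod : j % 2 = 1 ∨ j % 4 = 0 ∨ j % 4 = 2 := by omega
  rcases hmod with h | h | h
  · have k1 := sieve 3 8 2 1 1 [0] (by decide +kernel) 2 1 (-5)
      (by decide) (by decide) (by decide) (by decide) _ y e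
    have k2 := sieve 61 60 2 1 56 [8, 20, 32, 44] (by decide +kernel) 2 1 (-5)
      (by decide) (by decide) (by decide) (by decide) _ y e
    have hfin : ∀ t < 70, (8 + 12 * t) % 8 ∉ [0] →
        (8 + 12 * t) % 28 ∉ [6, 8, 10, 12, 16, 18, 20, 22] →
        (8 + 12 * t) % 60 ∉ [8, 20, 32, 44] → (8 + 12 * t) % 70 ∉ [16, 46, 54] →
        (8 + 12 * t) % 168 ∉ [86, 98, 140] → t = 69 := by decide +kernel
    have h0 : j / 2 % 70 = 69 := hfin (j / 2 % 70) (by omega)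
      (notmem k1 (by omega)) (notmem k13 (by omega))
      (notmem k2 (by omega)) (notmem k71 (by omega))
      (notmem k83 (by omega))
    have e2 : y ^ 2 = 2 * lu 7 (-4) (6 * j + 6) + -5 := by
      rw [show 6 * j + 6 = 4 + (6 * j + 2) by ring, lu_shift]
      simpa [lu] using e
    exact key19 _ _ (-5) y _ (by omega) (by omega) (by norm_num) e2
  · have k1 := sieve 281 56 2 1 276 [26] (by decide +kernel) 2 1 (-5)
      (by decide) (by decide) (by decide) (by decide) _ y e
    have hfin : ∀ t < 7, (2 + 24 * t) % 28 ∉ [6, 8, 10, 12, 16, 18, 20, 22] →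
        (2 + 24 * t) % 168 ∉ [86, 98, 140] → (2 + 24 * t) % 56 ∉ [26] → t = 0 := by decide +kernel
    have h0 : j / 4 % 7 = 0 := hfin (j / 4 % 7) (by omega)
      (notmem k13 (by omega)) (notmem k83 (by omega))
      (notmem k1 (by omega))
    rw [show 6 * j + 2 = 2 + 6 * j by ring, lu_shift] at e
    exact key11 _ _ (-5) y _ (by omega) (by omega) (by norm_num [lu]) e
  · have k1 := sieve 31 30 2 1 26 [8, 20] (by decide +kernel) 2 1 (-5)
      (by decide) (by decide) (by decide) (by decide) _ y e
    have k2 := sieve 41 40 2 1 36 [22] (by decide +kernel) 2 1 (-5)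
      (by decide) (by decide) (by decide) (by decide) _ y e
    have k3 := sieve 43 88 2 1 38 [30, 38, 46, 54, 70, 78] (by decide +kernel) 2 1 (-5)
      (by decide) (by decide) (by decide) (by decide) _ y e
    have k4 := sieve 89 44 2 1 84 [6, 18] (by decide +kernel) 2 1 (-5)
      (by decide) (by decide) (by decide) (by decide) _ y e
    have k5 := sieve 661 220 2 1 656 [66, 86, 146, 154] (by decide +kernel) 2 1 (-5)
      (by decide) (by decide) (by decide) (by decide) _ y e
    have k6 := sieve 9901 66 2 1 9896 [20] (by decide +kernel) 2 1 (-5)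
      (by decide) (by decide) (by decide) (by decide) _ y e
    have hfin : ∀ t < 385, (14 + 24 * t) % 28 ∉ [6, 8, 10, 12, 16, 18, 20, 22] →
        (14 + 24 * t) % 168 ∉ [86, 98, 140] → (14 + 24 * t) % 70 ∉ [16, 46, 54] →
        (14 + 24 * t) % 30 ∉ [8, 20] → (14 + 24 * t) % 40 ∉ [22] →
        t ∈ [0, 18, 28, 35, 53, 63, 70, 88, 98, 105, 123, 133, 140, 158, 168, 175, 193, 203, 210, 228, 238, 245, 263, 273, 280, 298, 308, 315, 333, 343, 350, 368, 378] := by decide +kernel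
    have hfin2 : ∀ t ∈ [0, 18, 28, 35, 53, 63, 70, 88, 98, 105, 123, 133, 140, 158, 168, 175, 193, 203, 210, 228, 238, 245, 263, 273, 280, 298, 308, 315, 333, 343, 350, 368, 378],
        (14 + 24 * t) % 88 ∉ [30, 38, 46, 54, 70, 78] → (14 + 24 * t) % 44 ∉ [6, 18] →
        (14 + 24 * t) % 220 ∉ [66, 86, 146, 154] → (14 + 24 * t) % 66 ∉ [20] →
        t = 0 := by decide +kernel
    have h0 : j / 4 % 385 = 0 := hfin2 (j / 4 % 385) (hfin (j / 4 % 385) (by omega)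
      (notmem k13 (by omega)) (notmem k83 (by omega))
      (notmem k71 (by omega)) (notmem k1 (by omega))
      (notmem k2 (by omega))) (notmem k3 (by omega))
      (notmem k4 (by omega)) (notmem k5 (by omega))
      (notmem k6 (by omega))
    obtain ⟨z, hz⟩ : ∃ z, 6 * j + 2 = 14 + z := ⟨6 * j - 12, by omega⟩
    rw [hz, lu_shift] at e
    exact key1691 _ _ (-5) y z (by omega) (by omega) (by norm_num [lu]) e

end GoldAux

namespace GoldAux

/-- The element `a + b ε`. -/
noncomputable def el (a b : ℤ) : GoldRing := (a : GoldRing) + (b : GoldRing) * ε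

theorem eps_sq : ε ^ 2 = ε + 1 := by
  have h := AdjoinRoot.eval₂_root (X ^ 2 - X - 1 : ℤ[X])
  simp only [eval₂_sub, eval₂_pow, eval₂_X, eval₂_one] at h
  have h' : ε ^ 2 - ε - 1 = 0 := h
  linear_combination h'

/-- Ring homs out of `GoldRing`. -/
noncomputable def hm {R : Type} [CommRing R] (t : R) (ht : t ^ 2 = t + 1) : GoldRing →+* R :=
  AdjoinRoot.lift (Int.castRingHom R) t (by simp [ht])

theorem hm_eps {R : Type} [CommRing R] (t : R) (ht : t ^ 2 = t + 1) : hm t ht ε = t :=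
  AdjoinRoot.lift_root _

theorem conj_sq : ε' ^ 2 = ε' + 1 := by
  unfold ε'; linear_combination eps_sq

theorem pow_fib {R : Type} [CommRing R] (t : R) (ht : t ^ 2 = t + 1) (n : ℕ) :
    t ^ (n + 1) = (Nat.fib n : R) + (Nat.fib (n + 1) : R) * t := by
  induction n with
  | zero => simp
  | succ n ih =>
    rw [pow_succ, ih, Nat.fib_add_two]; push_cast
    linear_combination (Nat.fib (n + 1) : R) * ht

theorem exists_el (x : GoldRing) : ∃ a b : ℤ, x = el a b := by
  induction x using AdjoinRoot.induction_on with
  | ih p =>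
    induction p using Polynomial.induction_on' with
    | add p q hp hq =>
      obtain ⟨a, b, h⟩ := hp
      obtain ⟨c, d, h'⟩ := hq
      exact ⟨a + c, b + d, by rw [map_add, h, h']; simp only [el]; push_cast; ring⟩
    | monomial n c =>
      have : AdjoinRoot.mk (X ^ 2 - X - 1 : ℤ[X]) (monomial n c) = (c : GoldRing) * ε ^ n := by
        rw [← C_mul_X_pow_eq_monomial, map_mul, map_pow]
        have : AdjoinRoot.mk (X ^ 2 - X - 1 : ℤ[X]) (C c) = (c : GoldRing) := by
          simp
        rw [this]; rfl
      rw [this]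
      rcases n with _ | n
      · exact ⟨c, 0, by simp [el]⟩
      · exact ⟨c * Nat.fib n, c * Nat.fib (n + 1), by
          rw [pow_fib ε eps_sq]; simp only [el]; push_cast; ring⟩

open Real in
/-- The first real embedding. -/
noncomputable def s1 : GoldRing →+* ℝ := hm goldenRatio goldenRatio_sq

open Real in
/-- The second real embedding. -/
noncomputable def s2 : GoldRing →+* ℝ := hm goldenConj goldenConj_sq

theorem s1_eps : s1 ε = Real.goldenRatio := hm_eps _ _
theorem s2_eps : s2 ε = Real.goldenConj := hm_eps _ _

theorem el_inj {a b c d : ℤ} (h : el a b = el c d) : a = c ∧ b = d := by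
  have h1 := congrArg s1 h
  simp only [el, map_add, map_mul, map_intCast, s1_eps] at h1
  have hb : b = d := by
    by_contra hne
    have hne' : ((b - d : ℤ) : ℝ) ≠ 0 := by exact_mod_cast sub_ne_zero.2 hne
    apply Real.goldenRatio_irrational
    refine ⟨((c - a : ℤ) : ℚ) / ((b - d : ℤ) : ℚ), ?_⟩
    push_cast at hne' ⊢
    rw [div_eq_iff hne']
    linear_combination -h1
  subst hb
  exact ⟨by exact_mod_cast add_right_cancel h1, rfl⟩

theorem el_mul (a b c d : ℤ) : el a b * el c d = el (a * c + b * d) (a * d + b * c + b * d) := by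
  simp only [el]; push_cast
  linear_combination (b * d : GoldRing) * eps_sq

theorem s1_inj : Function.Injective s1 := by
  rw [injective_iff_map_eq_zero]
  intro x hx
  obtain ⟨a, b, rfl⟩ := exists_el x
  have hx' := hx
  simp only [el, map_add, map_mul, map_intCast, s1_eps] at hx'
  have hb : b = 0 := by
    by_contra hne
    have hne' : (b : ℝ) ≠ 0 := by exact_mod_cast hne
    apply Real.goldenRatio_irrational
    refine ⟨((-a : ℤ) : ℚ) / (b : ℚ), ?_⟩
    push_cast
    rw [div_eq_iff hne']
    linear_combination -hx'
  subst hb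
  have : a = 0 := by simpa using hx'
  simp [el, this]

theorem sq_cases {x y : GoldRing} (h : x ^ 2 = y ^ 2) : x = y ∨ x = -y := by
  have h1 := congrArg s1 h
  rw [map_pow, map_pow, sq_eq_sq_iff_eq_or_eq_neg] at h1
  rcases h1 with h1 | h1
  · exact Or.inl (s1_inj h1)
  · exact Or.inr (s1_inj (by rw [h1, map_neg]))

/-- `ε` as a unit. -/
noncomputable def eta : GoldRingˣ where
  val := ε
  inv := ε - 1
  val_inv := by linear_combination eps_sq
  inv_val := by linear_combination eps_sq

theorem eta_val : (eta : GoldRing) = ε := rfl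
theorem eta_inv_val : ((eta⁻¹ : GoldRingˣ) : GoldRing) = ε - 1 := rfl

theorem norm_unit (a b : ℤ) (h : IsUnit (el a b)) :
    a ^ 2 + a * b - b ^ 2 = 1 ∨ a ^ 2 + a * b - b ^ 2 = -1 := by
  obtain ⟨y, hy⟩ := h.exists_right_inv
  obtain ⟨c, d, rfl⟩ := exists_el y
  rw [el_mul, show (1 : GoldRing) = el 1 0 by simp [el]] at hy
  obtain ⟨h1, h2⟩ := el_inj hy
  apply Int.isUnit_iff.1
  refine IsUnit.of_mul_eq_one (c ^ 2 + c * d - d ^ 2) ?_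
  have : (a ^ 2 + a * b - b ^ 2) * (c ^ 2 + c * d - d ^ 2) =
    (a * c + b * d) ^ 2 + (a * c + b * d) * (a * d + b * c + b * d)
      - (a * d + b * c + b * d) ^ 2 := by ring
  rw [this, h1, h2]; norm_num

/-- `x` is plus or minus a power of `ε`. -/
def PM (x : GoldRing) : Prop := ∃ n : ℤ, x = ((eta ^ n : GoldRingˣ) : GoldRing) ∨
  x = -((eta ^ n : GoldRingˣ) : GoldRing)

theorem PM_neg {x : GoldRing} (h : PM (-x)) : PM x := by
  obtain ⟨n, h | h⟩ := h
  · exact ⟨n, Or.inr (by rw [← h, neg_neg])⟩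
  · exact ⟨n, Or.inl (neg_injective h)⟩

theorem PM_mul {x : GoldRing} (h : PM (x * ε)) : PM x := by
  have key : ∀ n : ℤ, ((eta ^ n : GoldRingˣ) : GoldRing) * (ε - 1)
      = ((eta ^ (n - 1) : GoldRingˣ) : GoldRing) := by
    intro n
    rw [zpow_sub_one, Units.val_mul, eta_inv_val]
  obtain ⟨n, h⟩ := h
  refine ⟨n - 1, ?_⟩
  have hx : x = x * ε * (ε - 1) := by linear_combination (-x) * eps_sq
  rw [hx, ← key]
  rcases h with h | h
  · left; rw [h]
  · right; rw [h]; ring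

theorem PM_div {x : GoldRing} (h : PM (x * (ε - 1))) : PM x := by
  have key : ∀ n : ℤ, ((eta ^ n : GoldRingˣ) : GoldRing) * ε
      = ((eta ^ (n + 1) : GoldRingˣ) : GoldRing) := by
    intro n
    rw [zpow_add_one, Units.val_mul, eta_val]
  obtain ⟨n, h⟩ := h
  refine ⟨n + 1, ?_⟩
  have hx : x = x * (ε - 1) * ε := by linear_combination (-x) * eps_sq
  rw [hx, ← key]
  rcases h with h | h
  · left; rw [h]
  · right; rw [h]; ring

theorem PM_one : PM 1 := ⟨0, Or.inl (by simp)⟩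

theorem PM_eps : PM ε := PM_div (by
  have : ε * (ε - 1) = 1 := by linear_combination eps_sq
  rw [this]; exact PM_one)

theorem PM_of_norm (k : ℕ) : ∀ a b : ℤ, b.natAbs = k →
    (a ^ 2 + a * b - b ^ 2 = 1 ∨ a ^ 2 + a * b - b ^ 2 = -1) → PM (el a b) := by
  induction k using Nat.strong_induction_on with
  | _ k ih =>
    have main : ∀ a b : ℤ, b.natAbs = k → 0 < b →
        (a ^ 2 + a * b - b ^ 2 = 1 ∨ a ^ 2 + a * b - b ^ 2 = -1) → PM (el a b) := by
      intro a b hk hb hN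
      by_cases ha : 0 ≤ a
      · have hab : a ≤ b := by
          by_contra! hlt
          rcases hN with hN | hN <;> nlinarith
        rcases hab.lt_or_eq with hlt | heq
        · apply PM_div
          have : el a b * (ε - 1) = el (b - a) a := by
            simp only [el]; push_cast; linear_combination (b : GoldRing) * eps_sq
          rw [this]
          refine ih a.natAbs (by omega) _ _ rfl ?_
          rcases hN with hN | hN
          · right; linear_combination -hN
          · left; linear_combination -hN
        · subst heq
          have : a = 1 := by
            rcases hN with hN | hN <;> nlinarith
          subst this
          apply PM_div
          have : el 1 1 * (ε - 1) = ε := by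
            simp only [el]; push_cast; linear_combination eps_sq
          rw [this]; exact PM_eps
      · push Not at ha
        by_cases h2 : -(2 * b) < a
        · apply PM_mul
          have : el a b * ε = el b (a + b) := by
            simp only [el]; push_cast; linear_combination (b : GoldRing) * eps_sq
          rw [this]
          refine ih (a + b).natAbs (by omega) _ _ rfl ?_
          rcases hN with hN | hN
          · right; linear_combination -hN
          · left; linear_combination -hN
        · push Not at h2
          have hb1 : b = 1 := by
            rcases hN with hN | hN <;> nlinarith
          subst hb1
          have ha2 : a = -2 := by
            rcases hN with hN | hN <;> nlinarith
          subst ha2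
          apply PM_mul
          apply PM_mul
          apply PM_neg
          have : -(el (-2) 1 * ε * ε) = 1 := by
            simp only [el]; push_cast; linear_combination (1 - ε) * eps_sq
          rw [this]; exact PM_one
    intro a b hk hN
    rcases lt_trichotomy b 0 with hb | hb | hb
    · apply PM_neg
      have : -el a b = el (-a) (-b) := by simp only [el]; push_cast; ring
      rw [this]
      refine main (-a) (-b) (by omega) (by omega) ?_
      rcases hN with hN | hN
      · left; linear_combination hN
      · right; linear_combination hN
    · subst hb
      have : a = 1 ∨ a = -1 := by
        rcases hN with hN | hN
        · exact sq_eq_one_iff.1 (by linear_combination hN)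
        · nlinarith
      rcases this with rfl | rfl
      · have : el 1 0 = 1 := by simp [el]
        rw [this]; exact PM_one
      · apply PM_neg
        have : -el (-1) 0 = 1 := by simp [el]
        rw [this]; exact PM_one
    · exact main a b hk hb hN

theorem PM_unit (u : GoldRing) (hu : IsUnit u) : PM u := by
  obtain ⟨a, b, rfl⟩ := exists_el u
  exact PM_of_norm _ a b rfl (norm_unit a b hu)

end GoldAux

namespace GoldAux

/-- The conclusion of the theorem. -/
def Concl (x u v : GoldRing) : Prop :=
    ∃ w : GoldRing, IsUnit w ∧
      ((x = w * 1 ∧ u = w ^ 2 * 1 ∧ v = w ^ 2 * (-1)) ∨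
       (x = w * 1 ∧ u = w ^ 2 * (-ε) ∧ v = w ^ 2 * ε ^ 3) ∨
       (x = w * ε ∧ u = w ^ 2 * 1 ∧ v = w ^ 2 * (-ε')) ∨
       (x = w * sqrt5 ∧ u = w ^ 2 * ε ^ 2 ∧ v = w ^ 2 * ε' ^ 3) ∨
       (x = w * (8 + 15 * ε) ∧ u = w ^ 2 * ε ^ 13 ∧ v = w ^ 2 * ε') ∨
       (x = w * 1 ∧ u = w ^ 2 * (-ε') ∧ v = w ^ 2 * ε' ^ 3) ∨
       (x = w * ε' ∧ u = w ^ 2 * 1 ∧ v = w ^ 2 * (-ε)) ∨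
       (x = w * (-sqrt5) ∧ u = w ^ 2 * ε' ^ 2 ∧ v = w ^ 2 * ε ^ 3) ∨
       (x = w * (8 + 15 * ε') ∧ u = w ^ 2 * ε' ^ 13 ∧ v = w ^ 2 * ε))

theorem Concl_scale (t : GoldRingˣ) (x u v : GoldRing)
    (h : Concl (↑t * x) (↑t ^ 2 * u) (↑t ^ 2 * v)) : Concl x u v := by
  have e1 : ∀ a b : GoldRing, ↑t * a = b → a = ↑t⁻¹ * b := by
    rintro a _ rfl; simp
  have e2 : ∀ a b : GoldRing, (t : GoldRing) ^ 2 * a = b → a = (↑t⁻¹) ^ 2 * b := by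
    rintro a _ rfl
    rw [← mul_assoc, ← mul_pow]; simp
  obtain ⟨w, hw, h⟩ := h
  refine ⟨↑t⁻¹ * w, (Units.isUnit _).mul hw, ?_⟩
  have e1' : ∀ a b : GoldRing, ↑t * a = w * b → a = ↑t⁻¹ * w * b := by
    intro a b hab; rw [e1 _ _ hab, mul_assoc]
  have e2' : ∀ a b : GoldRing, (t : GoldRing) ^ 2 * a = w ^ 2 * b → a = (↑t⁻¹ * w) ^ 2 * b := by
    intro a b hab; rw [e2 _ _ hab]; ring
  refine h.imp ?_ (Or.imp ?_ (Or.imp ?_ (Or.imp ?_ (Or.imp ?_ (Or.imp ?_ (Or.imp ?_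
    (Or.imp ?_ ?_)))))))
  all_goals exact fun ⟨a, b, c⟩ => ⟨e1' _ _ a, e2' _ _ b, e2' _ _ c⟩

/-- Conjugation. -/
noncomputable def cj : GoldRing →+* GoldRing := hm ε' conj_sq

theorem cj_eps : cj ε = ε' := hm_eps _ _
theorem cj_eps' : cj ε' = ε := by
  rw [ε', map_sub, cj_eps, map_one, ε']; ring
theorem cj_sqrt5 : cj sqrt5 = -sqrt5 := by
  rw [sqrt5, map_sub, map_mul, cj_eps, map_one, map_ofNat, ε']; ring
theorem cj_cj (x : GoldRing) : cj (cj x) = x := by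
  obtain ⟨a, b, rfl⟩ := exists_el x
  simp [el, cj_eps, cj_eps']

theorem Concl_conj (x u v : GoldRing) (h : Concl (cj x) (cj u) (cj v)) : Concl x u v := by
  obtain ⟨w, hw, h⟩ := h
  refine ⟨cj w, hw.map cj, ?_⟩
  have e : ∀ a b : GoldRing, cj a = b → a = cj b := by
    rintro a _ rfl; rw [cj_cj]
  rcases h with h | h | h | h | h | h | h | h | h <;> obtain ⟨h1, h2, h3⟩ := h <;>
    replace h1 := e _ _ h1 <;> replace h2 := e _ _ h2 <;> replace h3 := e _ _ h3 <;>
    simp only [map_mul, map_pow, map_neg, map_one, map_add, map_ofNat, cj_eps, cj_eps',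
      cj_sqrt5, neg_neg] at h1 h2 h3
  · exact Or.inl ⟨h1, h2, h3⟩
  · exact Or.inr (Or.inr (Or.inr (Or.inr (Or.inr (Or.inl ⟨h1, h2, h3⟩)))))
  · exact Or.inr (Or.inr (Or.inr (Or.inr (Or.inr (Or.inr (Or.inl ⟨h1, h2, h3⟩))))))
  · exact Or.inr (Or.inr (Or.inr (Or.inr (Or.inr (Or.inr (Or.inr (Or.inl ⟨h1, h2, h3⟩)))))))
  · exact Or.inr (Or.inr (Or.inr (Or.inr (Or.inr (Or.inr (Or.inr (Or.inr ⟨h1, h2, h3⟩)))))))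
  · exact Or.inr (Or.inl ⟨h1, h2, h3⟩)
  · exact Or.inr (Or.inr (Or.inl ⟨h1, h2, h3⟩))
  · exact Or.inr (Or.inr (Or.inr (Or.inl ⟨h1, h2, h3⟩)))
  · exact Or.inr (Or.inr (Or.inr (Or.inr (Or.inl ⟨h1, h2, h3⟩))))

theorem two_mul_el (c d : ℤ) : 2 * el c d = el (2 * c) (2 * d) := by
  simp only [el]; push_cast; ring

/-- The case `v = 1`. -/
theorem case_one (x u : GoldRing) (hu : IsUnit u) (h : x ^ 2 = 2 * u + 1) : False := by
  obtain ⟨a, b, rfl⟩ := exists_el x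
  obtain ⟨c, d, rfl⟩ := exists_el u
  have hN := norm_unit c d hu
  rw [pow_two, el_mul, two_mul_el, show el (2 * c) (2 * d) + 1 = el (2 * c + 1) (2 * d) by
    simp only [el]; push_cast; ring] at h
  obtain ⟨h1, h2⟩ := el_inj h
  have hb : b % 2 = 0 := by
    rcases Int.emod_two_eq_zero_or_one b with hb | hb
    · exact hb
    · exfalso
      obtain ⟨k, rfl⟩ : ∃ k, b = 2 * k + 1 := ⟨b / 2, by omega⟩
      ring_nf at h2; omega
  obtain ⟨k, rfl⟩ : ∃ k, b = 2 * k := ⟨b / 2, by omega⟩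
  have ha : a % 2 = 1 := by
    rcases Int.emod_two_eq_zero_or_one a with ha | ha
    · exfalso
      obtain ⟨l, rfl⟩ : ∃ l, a = 2 * l := ⟨a / 2, by omega⟩
      ring_nf at h1; omega
    · exact ha
  obtain ⟨l, rfl⟩ : ∃ l, a = 2 * l + 1 := ⟨a / 2, by omega⟩
  have hc : c = 2 * (l ^ 2 + l + k ^ 2) := by linarith
  have hd : d = 2 * (k * (2 * l + 1) + k ^ 2) := by linarith
  generalize l ^ 2 + l + k ^ 2 = p at hc
  generalize k * (2 * l + 1) + k ^ 2 = q at hd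
  subst hc hd
  ring_nf at hN
  omega

/-- The case `v = -1`. -/
theorem case_neg_one (x u : GoldRing) (hu : IsUnit u) (h : x ^ 2 = 2 * u + -1) :
    Concl x u (-1) := by
  obtain ⟨a, b, rfl⟩ := exists_el x
  obtain ⟨c, d, rfl⟩ := exists_el u
  have hN := norm_unit c d hu
  rw [pow_two, el_mul, two_mul_el, show el (2 * c) (2 * d) + -1 = el (2 * c - 1) (2 * d) by
    simp only [el]; push_cast; ring] at h
  obtain ⟨h1, h2⟩ := el_inj h
  have key : 4 * (c ^ 2 + c * d - d ^ 2) =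
      (a ^ 2 + a * b - b ^ 2) ^ 2 + (2 * a ^ 2 + 2 * a * b + 3 * b ^ 2) + 1 := by
    have hc : 2 * c = a * a + b * b + 1 := by linarith
    have hd : 2 * d = a * b + b * a + b * b := by linarith
    have : 4 * (c ^ 2 + c * d - d ^ 2) = (2 * c) ^ 2 + (2 * c) * (2 * d) - (2 * d) ^ 2 := by ring
    rw [this, hc, hd]; ring
  have hS : 2 * a ^ 2 + 2 * a * b + 3 * b ^ 2 ≤ 3 := by
    rcases hN with hN | hN <;> rw [hN] at key <;> nlinarith [sq_nonneg (a ^ 2 + a * b - b ^ 2)]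
  have hb1 : b ≤ 1 := by nlinarith [sq_nonneg (2 * a + b)]
  have hb2 : -1 ≤ b := by nlinarith [sq_nonneg (2 * a + b)]
  have ha1 : a ≤ 1 := by nlinarith [sq_nonneg (a + 3 * b)]
  have ha2 : -1 ≤ a := by nlinarith [sq_nonneg (a + 3 * b)]
  have hcases : b = 0 ∧ (a = 1 ∨ a = -1) := by
    have hb : b = -1 ∨ b = 0 ∨ b = 1 := by omega
    have ha : a = -1 ∨ a = 0 ∨ a = 1 := by omega
    rcases hb with rfl | rfl | rfl <;> rcases ha with rfl | rfl | rfl <;> norm_num at * <;> omega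
  obtain ⟨rfl, ha⟩ := hcases
  have hd : d = 0 := by linarith
  have hc : c = 1 := by rcases ha with rfl | rfl <;> linarith
  subst hc hd
  rcases ha with rfl | rfl
  · exact ⟨1, isUnit_one, Or.inl (by simp [el])⟩
  · exact ⟨-1, isUnit_one.neg, Or.inl (by simp [el])⟩

theorem s1_eta (n : ℤ) : s1 ((eta ^ n : GoldRingˣ) : GoldRing) = Real.goldenRatio ^ n := by
  have : s1 ((eta ^ n : GoldRingˣ) : GoldRing) = ((Units.map (s1 : GoldRing →* ℝ) (eta ^ n) : ℝˣ) : ℝ) := rfl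
  rw [this, map_zpow, Units.val_zpow_eq_zpow_val]
  congr 1
  exact s1_eps

theorem s2_eta (n : ℤ) : s2 ((eta ^ n : GoldRingˣ) : GoldRing) = Real.goldenConj ^ n := by
  have : s2 ((eta ^ n : GoldRingˣ) : GoldRing) = ((Units.map (s2 : GoldRing →* ℝ) (eta ^ n) : ℝˣ) : ℝ) := rfl
  rw [this, map_zpow, Units.val_zpow_eq_zpow_val]
  congr 1
  exact s2_eps

theorem eta_cube (m : ℤ) : ∃ c d : ℤ, ((eta ^ (3 * m) : GoldRingˣ) : GoldRing) = el c d ∧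
    c % 2 = 1 ∧ d % 2 = 0 := by
  induction m using Int.induction_on with
  | zero => exact ⟨1, 0, by simp [el]⟩
  | succ i ih =>
    obtain ⟨c, d, h, hc, hd⟩ := ih
    refine ⟨c + 2 * d, 2 * c + 3 * d, ?_, by omega, by omega⟩
    rw [mul_add, mul_one, zpow_add, Units.val_mul, h]
    have : ((eta ^ (3 : ℤ) : GoldRingˣ) : GoldRing) = el 1 2 := by
      rw [show (3 : ℤ) = ((3 : ℕ) : ℤ) by rfl, zpow_natCast, Units.val_pow_eq_pow_val, eta_val]
      simp only [el]; push_cast; linear_combination (ε + 1) * eps_sq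
    rw [this, el_mul]; congr 1 <;> ring
  | pred i ih =>
    obtain ⟨c, d, h, hc, hd⟩ := ih
    refine ⟨-3 * c + 2 * d, 2 * c - d, ?_, by omega, by omega⟩
    rw [mul_sub, mul_one, sub_eq_add_neg (3 * -(i : ℤ)) 3, zpow_add, Units.val_mul, h]
    have : ((eta ^ (-3 : ℤ) : GoldRingˣ) : GoldRing) = el (-3) 2 := by
      rw [show (-3 : ℤ) = -((3 : ℕ) : ℤ) by rfl, zpow_neg, zpow_natCast, ← inv_pow,
        Units.val_pow_eq_pow_val, eta_inv_val]
      simp only [el]; push_cast; linear_combination (ε - 2) * eps_sq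
    rw [this, el_mul]; congr 1 <;> ring

theorem odd_coords (a b c d : ℤ) (h1 : a * a + b * b = 2 * c)
    (h2 : a * b + b * a + b * b = 2 * d + 1) : c % 2 = 1 ∧ d % 2 = 1 := by
  have hb : b % 2 = 1 := by
    rcases Int.emod_two_eq_zero_or_one b with hb | hb
    · exfalso
      obtain ⟨k, rfl⟩ : ∃ k, b = 2 * k := ⟨b / 2, by omega⟩
      ring_nf at h2; omega
    · exact hb
  obtain ⟨k, rfl⟩ : ∃ k, b = 2 * k + 1 := ⟨b / 2, by omega⟩
  have ha : a % 2 = 1 := by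
    rcases Int.emod_two_eq_zero_or_one a with ha | ha
    · exfalso
      obtain ⟨l, rfl⟩ : ∃ l, a = 2 * l := ⟨a / 2, by omega⟩
      ring_nf at h1; omega
    · exact ha
  obtain ⟨l, rfl⟩ : ∃ l, a = 2 * l + 1 := ⟨a / 2, by omega⟩
  have hc : c = 2 * (l ^ 2 + l + k ^ 2 + k) + 1 := by linarith
  have hd : d = 2 * (2 * l * k + l + 2 * k + k ^ 2) + 1 := by linarith
  constructor <;> omega

theorem mod3 (x : GoldRing) (n : ℤ) (u : GoldRing)
    (hu : u = ((eta ^ n : GoldRingˣ) : GoldRing) ∨ u = -((eta ^ n : GoldRingˣ) : GoldRing))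
    (h : x ^ 2 = 2 * u + ε) : n % 3 = 2 := by
  obtain ⟨a, b, rfl⟩ := exists_el x
  have main : ∀ c d : ℤ, u = el c d → c % 2 = 1 ∧ d % 2 = 1 := by
    rintro c d rfl
    rw [pow_two, el_mul, two_mul_el, show el (2 * c) (2 * d) + ε = el (2 * c) (2 * d + 1) by
      simp only [el]; push_cast; ring] at h
    obtain ⟨h1, h2⟩ := el_inj h
    exact odd_coords a b c d h1 h2
  obtain ⟨c, d, hcd, hc, hd⟩ := eta_cube (n / 3)
  have hneg : ∀ c d : ℤ, -el c d = el (-c) (-d) := by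
    intro c d; simp only [el]; push_cast; ring
  by_contra hn
  have hn' : n % 3 = 0 ∨ n % 3 = 1 := by omega
  rcases hn' with h0 | h0
  · rw [show n = 3 * (n / 3) by omega, hcd, hneg] at hu
    rcases hu with hu | hu
    · have := main _ _ hu; omega
    · have := main _ _ hu; omega
  · rw [show n = 3 * (n / 3) + 1 by omega, zpow_add_one, Units.val_mul, hcd, eta_val,
      show el c d * ε = el d (c + d) by
        simp only [el]; push_cast; linear_combination (d : GoldRing) * eps_sq, hneg] at hu
    rcases hu with hu | hu
    · have := main _ _ hu; omega
    · have := main _ _ hu; omega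

theorem conj_lt : Real.goldenConj < -(61 / 100 : ℝ) := by
  have h : (2.22 : ℝ) < √5 := Real.lt_sqrt_of_sq_lt (by norm_num)
  unfold Real.goldenConj
  linarith

/-- Positivity, positive sign. -/
theorem pos_plus (x : GoldRing) (n : ℤ) (hn3 : n % 3 = 2)
    (h : x ^ 2 = 2 * ((eta ^ n : GoldRingˣ) : GoldRing) + ε) : ∃ j : ℕ, n = 2 - 6 * j := by
  have h2 := congrArg s2 h
  rw [map_pow, map_add, map_mul, map_ofNat, s2_eta, s2_eps] at h2
  have hnn := sq_nonneg (s2 x)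
  rw [h2] at hnn
  have hc := conj_lt
  have heven : Even n := by
    by_contra ho
    rw [Int.not_even_iff_odd] at ho
    have := ho.zpow_neg (a := Real.goldenConj) (by linarith)
    linarith
  have he := Int.even_iff.1 heven
  by_contra! hj
  have hn : 2 < n := by
    by_contra! hle
    exact hj ((2 - n) / 6).toNat (by omega)
  obtain ⟨i, rfl⟩ : ∃ i : ℕ, n = ((8 + 2 * (3 * i) : ℕ) : ℤ) := ⟨((n - 8) / 6).toNat, by omega⟩
  rw [zpow_natCast, pow_add, pow_mul] at hnn
  have hlo := Real.neg_one_lt_goldenConj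
  have hsq := Real.goldenConj_sq
  have h1 : (Real.goldenConj ^ 2) ^ (3 * i) ≤ 1 := pow_le_one₀ (sq_nonneg _) (by linarith)
  have h8 : Real.goldenConj ^ 8 = 21 * Real.goldenConj + 13 := by
    rw [pow_fib _ hsq 7]; norm_num [Nat.fib]; ring
  have h8' : 0 ≤ Real.goldenConj ^ 8 := by positivity
  have := mul_le_mul_of_nonneg_left h1 h8'
  linarith

/-- Positivity, negative sign. -/
theorem pos_minus (x : GoldRing) (n : ℤ) (hn3 : n % 3 = 2)
    (h : x ^ 2 = 2 * -((eta ^ n : GoldRingˣ) : GoldRing) + ε) : ∃ j : ℕ, n = -1 - 6 * j := by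
  have h2 := congrArg s2 h
  rw [map_pow, map_add, map_mul, map_ofNat, map_neg, s2_eta, s2_eps] at h2
  have hnn := sq_nonneg (s2 x)
  rw [h2] at hnn
  have h1 := congrArg s1 h
  rw [map_pow, map_add, map_mul, map_ofNat, map_neg, s1_eta, s1_eps] at h1
  have hnn1 := sq_nonneg (s1 x)
  rw [h1] at hnn1
  have hc := conj_lt
  have hodd : Odd n := by
    by_contra ho
    rw [Int.not_odd_iff_even] at ho
    have := ho.zpow_pos (a := Real.goldenConj) (by linarith)
    linarith
  have he := Int.odd_iff.1 hodd
  by_contra! hj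
  have hn : -1 < n := by
    by_contra! hle
    exact hj ((-1 - n) / 6).toNat (by omega)
  have h1' := Real.one_lt_goldenRatio
  have : Real.goldenRatio ^ (1 : ℤ) ≤ Real.goldenRatio ^ n :=
    zpow_le_zpow_right₀ h1'.le (by omega)
  rw [zpow_one] at this
  linarith

theorem eta_neg_pow (k : ℕ) : ((eta ^ (-(k : ℤ)) : GoldRingˣ) : GoldRing) = (ε - 1) ^ k := by
  rw [zpow_neg, zpow_natCast, ← inv_pow, Units.val_pow_eq_pow_val, eta_inv_val]

theorem eps_inv : ε * (ε - 1) = 1 := by linear_combination eps_sq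

theorem isUnit_inv : IsUnit (ε - 1) := by rw [← eta_inv_val]; exact Units.isUnit _

theorem eps_pow_el (n : ℕ) : ε ^ (n + 1) = el (Nat.fib n) (Nat.fib (n + 1)) := by
  rw [pow_fib _ eps_sq]; simp [el]

/-- Branch A. -/
theorem branchA (x : GoldRing) (j : ℕ)
    (h : x ^ 2 = 2 * ((eta ^ (2 - 6 * j : ℤ) : GoldRingˣ) : GoldRing) + ε) :
    Concl x ((eta ^ (2 - 6 * j : ℤ) : GoldRingˣ) : GoldRing) ε := by
  have hu : ((eta ^ (2 - 6 * j : ℤ) : GoldRingˣ) : GoldRing) = ε ^ 2 * (ε - 1) ^ (6 * j) := by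
    rw [sub_eq_add_neg (2 : ℤ) (6 * (j : ℤ)), zpow_add, Units.val_mul]
    have := eta_neg_pow (6 * j)
    push_cast at this
    rw [this]; congr 1
  rw [hu] at h ⊢
  have hX : (x * ε ^ (3 * j)) ^ 2 = 2 * ε ^ 2 + ε ^ (6 * j + 1) := by
    have : (ε * (ε - 1)) ^ (6 * j) = 1 := by rw [eps_inv, one_pow]
    rw [mul_pow, h, ← pow_mul, show 3 * j * 2 = 6 * j by ring]
    rw [mul_pow] at this
    linear_combination 2 * ε ^ 2 * this
  obtain ⟨a, b, hab⟩ := exists_el (x * ε ^ (3 * j))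
  have hX' := hX
  rw [hab, eps_pow_el (6 * j), pow_two, el_mul, show 2 * ε ^ 2 + el (Nat.fib (6 * j)) (Nat.fib (6 * j + 1))
    = el (2 + Nat.fib (6 * j)) (2 + Nat.fib (6 * j + 1)) by
      simp only [el]; push_cast; linear_combination 2 * eps_sq] at hX'
  obtain ⟨h1, h2⟩ := el_inj hX'
  have hy : (a ^ 2 + a * b - b ^ 2) ^ 2 = 2 * lu (-1) 2 (6 * j) + 3 := by
    have hc := cassini (6 * j)
    rw [Even.neg_one_pow ⟨3 * j, by ring⟩] at hc
    have : (a ^ 2 + a * b - b ^ 2) ^ 2 = (a * a + b * b) ^ 2 +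
      (a * a + b * b) * (a * b + b * a + b * b) - (a * b + b * a + b * b) ^ 2 := by ring
    rw [this, h1, h2, lu_fib]
    linear_combination hc
  rcases solveA j _ hy with rfl | rfl
  · have : x = ε ^ 2 ∨ x = -ε ^ 2 := sq_cases (by
      rw [h]; simp only [mul_zero, pow_zero]; linear_combination (-ε ^ 2 - ε) * eps_sq)
    rcases this with rfl | rfl
    · refine ⟨ε, eta.isUnit, Or.inr (Or.inr (Or.inl ⟨by ring, by ring, ?_⟩))⟩
      rw [ε']; linear_combination (-ε) * eps_sq
    · refine ⟨-ε, eta.isUnit.neg, Or.inr (Or.inr (Or.inl ⟨by ring, by ring, ?_⟩))⟩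
      rw [ε']; linear_combination (-ε) * eps_sq
  · have hu4 : ε ^ 2 * (ε - 1) ^ (6 * 1) = (ε - 1) ^ 4 := by
      have : (ε * (ε - 1)) ^ 2 = 1 := by rw [eps_inv, one_pow]
      linear_combination (ε - 1) ^ 4 * this
    rw [hu4] at h ⊢
    have hv : ε = (ε - 1) ^ 2 * ε ^ 3 := by
      have : (ε * (ε - 1)) ^ 2 = 1 := by rw [eps_inv, one_pow]
      linear_combination (-ε) * this
    have : x = (ε - 1) * sqrt5 ∨ x = -((ε - 1) * sqrt5) := sq_cases (by
      have hinv2 : (ε - 1) ^ 2 = 2 - ε := by linear_combination eps_sq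
      rw [h, mul_pow, sqrt5, show (ε - 1) ^ 4 = ((ε - 1) ^ 2) ^ 2 by ring, hinv2]
      linear_combination (4 * ε - 6) * eps_sq)
    rcases this with rfl | rfl
    · refine ⟨-(ε - 1), isUnit_inv.neg, Or.inr (Or.inr (Or.inr (Or.inr (Or.inr (Or.inr (Or.inr
        (Or.inl ⟨by ring, ?_, ?_⟩)))))))⟩
      · rw [ε']; ring
      · rw [neg_sq]; exact hv
    · refine ⟨ε - 1, isUnit_inv, Or.inr (Or.inr (Or.inr (Or.inr (Or.inr (Or.inr (Or.inr
        (Or.inl ⟨by ring, ?_, ?_⟩)))))))⟩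
      · rw [ε']; ring
      · exact hv

/-- Branch B. -/
theorem branchB (x : GoldRing) (j : ℕ)
    (h : x ^ 2 = 2 * -((eta ^ (-1 - 6 * j : ℤ) : GoldRingˣ) : GoldRing) + ε) :
    Concl x (-((eta ^ (-1 - 6 * j : ℤ) : GoldRingˣ) : GoldRing)) ε := by
  have hu : ((eta ^ (-1 - 6 * j : ℤ) : GoldRingˣ) : GoldRing) = (ε - 1) ^ (6 * j + 1) := by
    have := eta_neg_pow (6 * j + 1)
    rw [← this]; congr 2; push_cast; ring
  rw [hu] at h ⊢
  have hX : (x * ε ^ (3 * j + 1)) ^ 2 = -2 * ε + ε ^ (6 * j + 2 + 1) := by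
    have : (ε * (ε - 1)) ^ (6 * j + 1) = 1 := by rw [eps_inv, one_pow]
    rw [mul_pow, h, ← pow_mul, show (3 * j + 1) * 2 = 6 * j + 1 + 1 by ring]
    rw [mul_pow] at this
    linear_combination -2 * ε * this
  obtain ⟨a, b, hab⟩ := exists_el (x * ε ^ (3 * j + 1))
  have hX' := hX
  rw [hab, eps_pow_el, pow_two, el_mul, show -2 * ε + el (Nat.fib (6 * j + 2))
      (Nat.fib (6 * j + 2 + 1))
    = el (Nat.fib (6 * j + 2)) (-2 + Nat.fib (6 * j + 2 + 1)) by
      simp only [el]; push_cast; ring] at hX'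
  obtain ⟨h1, h2⟩ := el_inj hX'
  have hy : (a ^ 2 + a * b - b ^ 2) ^ 2 = 2 * lu 2 1 (6 * j + 2) - 5 := by
    have hc := cassini (6 * j + 2)
    rw [Even.neg_one_pow ⟨3 * j + 1, by ring⟩] at hc
    have : (a ^ 2 + a * b - b ^ 2) ^ 2 = (a * a + b * b) ^ 2 +
      (a * a + b * b) * (a * b + b * a + b * b) - (a * b + b * a + b * b) ^ 2 := by ring
    rw [this, h1, h2, lu_fib]
    linear_combination hc
  rcases solveB j _ hy with rfl | rfl
  · have : x = (ε - 1) ∨ x = -(ε - 1) := sq_cases (by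
      rw [h]; simp only [mul_zero, zero_add, pow_one]; linear_combination -eps_sq)
    have hu1 : -(ε - 1) ^ (6 * 0 + 1) = (ε - 1) ^ 2 * (-ε) := by
      linear_combination (ε - 1) * eps_inv
    have hv : ε = (ε - 1) ^ 2 * ε ^ 3 := by
      have : (ε * (ε - 1)) ^ 2 = 1 := by rw [eps_inv, one_pow]
      linear_combination (-ε) * this
    rcases this with rfl | rfl
    · exact ⟨ε - 1, isUnit_inv, Or.inr (Or.inl ⟨by ring, hu1, hv⟩)⟩
    · exact ⟨-(ε - 1), isUnit_inv.neg, Or.inr (Or.inl ⟨by ring, by rw [neg_sq]; exact hu1,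
        by rw [neg_sq]; exact hv⟩)⟩
  · have hu13 : -(ε - 1) ^ (6 * 2 + 1) = ε' ^ 13 := by rw [ε']; ring
    have h13 : ε' ^ 13 = 144 + 233 * ε' := by
      rw [pow_fib _ conj_sq 12]; norm_num [Nat.fib]
    rw [hu13] at h ⊢
    have : x = 8 + 15 * ε' ∨ x = -(8 + 15 * ε') := sq_cases (by
      rw [h, h13]
      have : ε = 1 - ε' := by rw [ε']; ring
      rw [this]; linear_combination -225 * conj_sq)
    rcases this with rfl | rfl
    · exact ⟨1, isUnit_one, Or.inr (Or.inr (Or.inr (Or.inr (Or.inr (Or.inr (Or.inr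
        (Or.inr ⟨by ring, by ring, by ring⟩)))))))⟩
    · exact ⟨-1, isUnit_one.neg, Or.inr (Or.inr (Or.inr (Or.inr (Or.inr (Or.inr (Or.inr
        (Or.inr ⟨by ring, by ring, by ring⟩)))))))⟩

/-- The case `v = ε`. -/
theorem case_eps (x u : GoldRing) (hu : IsUnit u) (h : x ^ 2 = 2 * u + ε) : Concl x u ε := by
  obtain ⟨n, hn⟩ := PM_unit u hu
  have h3 := mod3 x n u hn h
  rcases hn with rfl | rfl
  · obtain ⟨j, rfl⟩ := pos_plus x n h3 h
    exact branchA x j h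
  · obtain ⟨j, rfl⟩ := pos_minus x n h3 h
    exact branchB x j h

/-- The case `v = -ε`. -/
theorem case_neg_eps (x u : GoldRing) (hu : IsUnit u) (h : x ^ 2 = 2 * u + -ε) :
    Concl x u (-ε) := by
  apply Concl_conj
  apply Concl_scale eta
  have hv : (eta : GoldRing) ^ 2 * cj (-ε) = ε := by
    rw [map_neg, cj_eps, eta_val, ε']; linear_combination ε * eps_sq
  rw [hv]
  refine case_eps _ _ ((eta.isUnit.pow 2).mul (hu.map cj)) ?_
  have := congrArg cj h
  rw [map_pow, map_add, map_mul, map_ofNat] at this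
  rw [mul_pow, this]
  linear_combination hv

theorem main (x u v : GoldRing) (hu : IsUnit u) (hv : IsUnit v) (h : x ^ 2 = 2 * u + v) :
    Concl x u v := by
  obtain ⟨n, hn⟩ := PM_unit v hv
  apply Concl_scale (eta ^ (-(n / 2)))
  have hsq : ((eta ^ (-(n / 2)) : GoldRingˣ) : GoldRing) ^ 2 * ((eta ^ n : GoldRingˣ) : GoldRing)
      = ((eta ^ (n % 2) : GoldRingˣ) : GoldRing) := by
    rw [← Units.val_pow_eq_pow_val, ← Units.val_mul, ← zpow_natCast, ← zpow_mul, ← zpow_add]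
    congr 2; push_cast; omega
  have hu' : IsUnit (((eta ^ (-(n / 2)) : GoldRingˣ) : GoldRing) ^ 2 * u) :=
    ((Units.isUnit _).pow 2).mul hu
  have h' : (((eta ^ (-(n / 2)) : GoldRingˣ) : GoldRing) * x) ^ 2 =
      2 * (((eta ^ (-(n / 2)) : GoldRingˣ) : GoldRing) ^ 2 * u) +
      ((eta ^ (-(n / 2)) : GoldRingˣ) : GoldRing) ^ 2 * v := by
    rw [mul_pow, h]; ring
  have hv' : ((eta ^ (-(n / 2)) : GoldRingˣ) : GoldRing) ^ 2 * v
        = ((eta ^ (n % 2) : GoldRingˣ) : GoldRing) ∨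
      ((eta ^ (-(n / 2)) : GoldRingˣ) : GoldRing) ^ 2 * v
        = -((eta ^ (n % 2) : GoldRingˣ) : GoldRing) := by
    rcases hn with rfl | rfl
    · left; exact hsq
    · right; rw [← hsq]; ring
  generalize ((eta ^ (-(n / 2)) : GoldRingˣ) : GoldRing) ^ 2 * v = v' at *
  generalize ((eta ^ (-(n / 2)) : GoldRingˣ) : GoldRing) ^ 2 * u = u' at *
  generalize ((eta ^ (-(n / 2)) : GoldRingˣ) : GoldRing) * x = x' at *
  rcases Int.emod_two_eq_zero_or_one n with h0 | h0 <;> rw [h0] at hv' <;>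
    simp only [zpow_zero, zpow_one, Units.val_one, eta_val] at hv' <;>
    rcases hv' with rfl | rfl
  · exact (case_one _ _ hu' h').elim
  · exact case_neg_one _ _ hu' h'
  · exact case_eps _ _ hu' h'
  · exact case_neg_eps _ _ hu' h'

end GoldAux

/-- Every solution of `x² = 2u + v` with `u, v` units of `ℤ[ε]` is, up to scaling by
the square of a unit (and taking conjugates, which are listed explicitly), one of
`1² = 2·1 - 1`, `1² = 2(-ε) + ε³`, `ε² = 2·1 - ε'`, `(√5)² = 2ε² + ε'³`,
`(8+15ε)² = 2ε¹³ + ε'`. -/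
theorem sq_eq_two_mul_unit_add_unit (x u v : GoldRing)
    (hu : IsUnit u) (hv : IsUnit v) (h : x ^ 2 = 2 * u + v) :
    ∃ w : GoldRing, IsUnit w ∧
      ((x = w * 1 ∧ u = w ^ 2 * 1 ∧ v = w ^ 2 * (-1)) ∨
       (x = w * 1 ∧ u = w ^ 2 * (-ε) ∧ v = w ^ 2 * ε ^ 3) ∨
       (x = w * ε ∧ u = w ^ 2 * 1 ∧ v = w ^ 2 * (-ε')) ∨
       (x = w * sqrt5 ∧ u = w ^ 2 * ε ^ 2 ∧ v = w ^ 2 * ε' ^ 3) ∨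
       (x = w * (8 + 15 * ε) ∧ u = w ^ 2 * ε ^ 13 ∧ v = w ^ 2 * ε') ∨
       (x = w * 1 ∧ u = w ^ 2 * (-ε') ∧ v = w ^ 2 * ε' ^ 3) ∨
       (x = w * ε' ∧ u = w ^ 2 * 1 ∧ v = w ^ 2 * (-ε)) ∨
       (x = w * (-sqrt5) ∧ u = w ^ 2 * ε' ^ 2 ∧ v = w ^ 2 * ε ^ 3) ∨
       (x = w * (8 + 15 * ε') ∧ u = w ^ 2 * ε' ^ 13 ∧ v = w ^ 2 * ε)) := by
  exact GoldAux.main x u v hu hv h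
end
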